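/- For the urn process with b(i) = w(2i) and r(i) = w(2i+1) (the '−'-urn), the expected discrepancy at blue-draw times converges: lim_{n→∞} E[𝔇_{τ_n^𝔅}] = −(4α+1)/(2(2α+1)). -/

import Mathlib

open MeasureTheory ProbabilityTheory Filter

/-- The asymptotic condition `1/w(n) = n^α (1 + 2B/n + O(1/n²))` on the weight function. -/
def WeightAsymp (w : ℕ → ℝ) (α B : ℝ) : Prop :=
  ∃ C₀ > (0:ℝ), ∃ N₀ : ℕ, ∀ n : ℕ, N₀ ≤ n →
    |1 / w n - (n:ℝ) ^ α - 2 * B * (n:ℝ) ^ (α - 1)| ≤ C₀ * (n:ℝ) ^ (α - 2)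

/-- The three admissible choices of `(b, r)` in terms of the weight function `w`. -/
def UrnChoice (w b r : ℕ → ℝ) : Prop :=
  (∀ i, b i = w (2*i) ∧ r i = w (2*i+1)) ∨
  (∀ i, b i = w (2*i+1) ∧ r i = w (2*i)) ∨
  (∀ i, b i = w (2*i) ∧ r i = w (2*i))

/-- A generalized Pólya urn process: `Bl n` and `Re n` are the numbers of blue and red
balls drawn in the first `n` draws; started at `(0,0)`, exactly one coordinate increases
by `1` at each step, and conditionally on the past the blue coordinate increases with
probability `b(Bl n)/(b(Bl n) + r(Re n))`. -/
structure Urn {Ω : Type*} [MeasurableSpace Ω] (μ : Measure Ω) (b r : ℕ → ℝ) where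
  Bl : ℕ → Ω → ℕ
  Re : ℕ → Ω → ℕ
  meas_Bl : ∀ n, Measurable (Bl n)
  meas_Re : ∀ n, Measurable (Re n)
  init_Bl : ∀ ω, Bl 0 ω = 0
  init_Re : ∀ ω, Re 0 ω = 0
  step : ∀ n ω, (Bl (n+1) ω = Bl n ω + 1 ∧ Re (n+1) ω = Re n ω) ∨
                (Bl (n+1) ω = Bl n ω ∧ Re (n+1) ω = Re n ω + 1)
  markov : ∀ n : ℕ,
    μ[(fun ω => if Bl (n+1) ω = Bl n ω + 1 then (1:ℝ) else 0) |
        ⨆ j ∈ Set.Iic n, MeasurableSpace.comap (fun ω => (Bl j ω, Re j ω)) inferInstance]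
      =ᵐ[μ] fun ω => b (Bl n ω) / (b (Bl n ω) + r (Re n ω))

namespace Urn

variable {Ω : Type*} [MeasurableSpace Ω] {μ : Measure Ω} {b r : ℕ → ℝ}

/-- The discrepancy `𝔇_n = ℜ_n − 𝔅_n`. -/
def D (U : Urn μ b r) (n : ℕ) (ω : Ω) : ℤ := (U.Re n ω : ℤ) - (U.Bl n ω : ℤ)

/-- `τ_k^𝔅`, the number of draws until the `k`-th blue ball. -/
noncomputable def tau (U : Urn μ b r) : ℕ → Ω → ℕ
  | 0 => fun _ => 0
  | k+1 => fun ω => sInf {n : ℕ | U.tau k ω < n ∧ U.Bl n ω = U.Bl (n-1) ω + 1}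

/-- The natural filtration `ℱ_n = σ((𝔅_j, ℜ_j), j ≤ n)`. -/
def F (U : Urn μ b r) (n : ℕ) : MeasurableSpace Ω :=
  ⨆ j ∈ Set.Iic n, MeasurableSpace.comap (fun ω => (U.Bl j ω, U.Re j ω)) inferInstance

end Urn

open Asymptotics Topology in
/-- Second order Taylor expansion of `(1 + y) ^ a` at `0`. -/
theorem rpow_one_add_sub_isLittleO_sq (a : ℝ) :
    (fun y : ℝ => (1 + y) ^ a - 1 - a * y - a * (a - 1) / 2 * y ^ 2)
      =o[𝓝 0] fun y : ℝ => y ^ 2 := by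
  have h := (Real.one_add_rpow_hasFPowerSeriesAt_zero (a := a)).isBigO_sub_partialSum_pow 3
  have h2 : (fun y : ℝ => ‖y‖ ^ 3) =o[𝓝 0] fun y : ℝ => y ^ 2 := by
    have h3 : (fun y : ℝ => y ^ 3) =o[𝓝 0] fun y : ℝ => y ^ 2 :=
      isLittleO_pow_pow (by norm_num)
    refine h3.norm_left.congr_left fun y => ?_
    simp
  refine (h.trans_isLittleO h2).congr_left fun y => ?_
  simp only [zero_add, FormalMultilinearSeries.partialSum, Finset.sum_range_succ,
    Finset.sum_range_zero, binomialSeries_apply]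
  have c2 : Ring.choose a 2 = a * (a - 1) / 2 := by
    rw [Ring.choose_eq_smul]
    simp [descPochhammer_succ_right, ← Polynomial.aeval_eq_smeval]
    ring
  simp [c2]
  ring

open Asymptotics Topology in
/-- First order Taylor expansion of `(1 + y) ^ a` at `0`. -/
theorem rpow_one_add_sub_isLittleO (a : ℝ) :
    (fun y : ℝ => (1 + y) ^ a - 1 - a * y) =o[𝓝 0] fun y : ℝ => y := by
  have h1 : (fun y : ℝ => y ^ 2) =o[𝓝 0] fun y : ℝ => y := by
    simpa using (isLittleO_pow_pow (𝕜 := ℝ) (m := 1) (n := 2) (by norm_num))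
  have h2 := ((rpow_one_add_sub_isLittleO_sq a).trans h1).add
    (h1.const_mul_left (a * (a - 1) / 2))
  refine h2.congr_left fun y => ?_
  ring

open Asymptotics Topology in
theorem nat_add_rpow_sub_isLittleO (a t : ℝ) :
    (fun j : ℕ => ((j : ℝ) + t) ^ a - (j : ℝ) ^ a - a * t * (j : ℝ) ^ (a - 1))
      =o[atTop] fun j : ℕ => (j : ℝ) ^ (a - 1) := by
  have ht : Tendsto (fun j : ℕ => t / (j : ℝ)) atTop (𝓝 0) :=
    tendsto_const_div_atTop_nhds_zero_nat t
  have h := (rpow_one_add_sub_isLittleO a).comp_tendsto ht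
  have h1 : (fun j : ℕ => t / (j : ℝ)) =O[atTop] fun j : ℕ => (j : ℝ)⁻¹ := by
    simp_rw [div_eq_mul_inv]
    exact (isBigO_refl _ _).const_mul_left t
  have h2 := (isBigO_refl (fun j : ℕ => (j : ℝ) ^ a) atTop).mul_isLittleO (h.trans_isBigO h1)
  refine h2.congr' ?_ ?_
  · filter_upwards [eventually_gt_atTop 0, ht.eventually (lt_mem_nhds (show (-1 : ℝ) < 0 by norm_num))]
      with j hj hj2
    have hj' : (0 : ℝ) < j := by exact_mod_cast hj
    have e : (j : ℝ) + t = j * (1 + t / j) := by field_simp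
    simp only [Function.comp]
    rw [e, Real.mul_rpow hj'.le (by linarith), Real.rpow_sub_one hj'.ne']
    field_simp
  · filter_upwards [eventually_gt_atTop 0] with j hj
    have hj' : (0 : ℝ) < j := by exact_mod_cast hj
    rw [Real.rpow_sub_one hj'.ne', div_eq_mul_inv]

open Asymptotics Topology in
theorem nat_succ_rpow_sub_isLittleO_sq (a : ℝ) :
    (fun j : ℕ => ((j : ℝ) + 1) ^ a - (j : ℝ) ^ a - a * (j : ℝ) ^ (a - 1)
        - a * (a - 1) / 2 * (j : ℝ) ^ (a - 2))
      =o[atTop] fun j : ℕ => (j : ℝ) ^ (a - 2) := by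
  have ht : Tendsto (fun j : ℕ => 1 / (j : ℝ)) atTop (𝓝 0) :=
    tendsto_const_div_atTop_nhds_zero_nat 1
  have h := (rpow_one_add_sub_isLittleO_sq a).comp_tendsto ht
  have h2 := (isBigO_refl (fun j : ℕ => (j : ℝ) ^ a) atTop).mul_isLittleO h
  refine h2.congr' ?_ ?_
  · filter_upwards [eventually_gt_atTop 0] with j hj
    have hj' : (0 : ℝ) < j := by exact_mod_cast hj
    have e : (j : ℝ) + 1 = j * (1 + 1 / j) := by field_simp
    have e2 : (j : ℝ) ^ (a - 2) = (j : ℝ) ^ a / j ^ 2 := by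
      exact_mod_cast Real.rpow_sub_natCast hj'.ne' a 2
    simp only [Function.comp]
    rw [e, Real.mul_rpow hj'.le (by positivity), Real.rpow_sub_one hj'.ne', e2]
    field_simp
  · filter_upwards [eventually_gt_atTop 0] with j hj
    have hj' : (0 : ℝ) < j := by exact_mod_cast hj
    have e2 : (j : ℝ) ^ (a - 2) = (j : ℝ) ^ a / j ^ 2 := by
      exact_mod_cast Real.rpow_sub_natCast hj'.ne' a 2
    simp only [Function.comp]
    rw [e2]
    field_simp

open Asymptotics Topology in
/-- A Stolz-type lemma: increments `o(n ^ (a - 1))` sum up to `o(n ^ a)`. -/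
theorem isLittleO_rpow_of_sub_isLittleO {u : ℕ → ℝ} {a : ℝ} (ha : 0 < a)
    (h : (fun n => u (n + 1) - u n) =o[atTop] fun n : ℕ => (n : ℝ) ^ (a - 1)) :
    u =o[atTop] fun n : ℕ => (n : ℝ) ^ a := by
  set g : ℕ → ℝ := fun j => ((j : ℝ) + 1) ^ a - (j : ℝ) ^ a with hg
  have hsum : ∀ n : ℕ, ∑ i ∈ Finset.range n, g i = (n : ℝ) ^ a := by
    intro n
    have := Finset.sum_range_sub (fun j : ℕ => (j : ℝ) ^ a) n
    simp only [Nat.cast_add, Nat.cast_one, Nat.cast_zero, Real.zero_rpow ha.ne', sub_zero] at this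
    simpa [hg] using this
  have htop : Tendsto (fun n : ℕ => (n : ℝ) ^ a) atTop atTop :=
    (tendsto_rpow_atTop ha).comp tendsto_natCast_atTop_atTop
  have hO : (fun n : ℕ => (n : ℝ) ^ (a - 1)) =O[atTop] g := by
    have h1 := nat_add_rpow_sub_isLittleO a 1
    have h2 : (fun j : ℕ => a * (j : ℝ) ^ (a - 1)) =O[atTop] fun j : ℕ =>
        ((j : ℝ) + 1) ^ a - (j : ℝ) ^ a - a * 1 * (j : ℝ) ^ (a - 1) + a * (j : ℝ) ^ (a - 1) :=
      (h1.trans_isBigO ((isBigO_refl _ _).const_mul_right ha.ne')).right_isBigO_add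
    refine (isBigO_of_le' (c := a⁻¹) _ fun j => ?_).trans
      (h2.trans (isBigO_of_le _ fun j => ?_))
    · rw [norm_mul, Real.norm_of_nonneg ha.le, inv_mul_cancel_left₀ ha.ne']
    · apply le_of_eq
      congr 1
      simp only [hg]
      ring
  have h3 := (h.trans_isBigO hO).sum_range (fun j => by
    simp only [hg, Pi.zero_apply, sub_nonneg]
    exact Real.rpow_le_rpow (Nat.cast_nonneg _) (by linarith) ha.le) (by simpa [hsum] using htop)
  simp only [hsum] at h3
  have h4 : (fun _ : ℕ => u 0) =o[atTop] fun n : ℕ => (n : ℝ) ^ a := by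
    rw [isLittleO_const_left]
    right
    exact tendsto_norm_atTop_atTop.comp htop
  refine (h3.add h4).congr_left fun n => ?_
  rw [Finset.sum_range_sub]
  ring

open Asymptotics Topology in
theorem nat_rpow_sub_one_isLittleO (a : ℝ) :
    (fun j : ℕ => (j : ℝ) ^ (a - 1)) =o[atTop] fun j : ℕ => (j : ℝ) ^ a := by
  have h1 : (fun j : ℕ => (j : ℝ)⁻¹) =o[atTop] fun _ => (1 : ℝ) :=
    (isLittleO_one_iff ℝ).2 tendsto_inv_atTop_nhds_zero_nat
  refine ((isBigO_refl (fun j : ℕ => (j : ℝ) ^ a) atTop).mul_isLittleO h1).congr' ?_ ?_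
  · filter_upwards [eventually_gt_atTop 0] with j hj
    rw [Real.rpow_sub_one (by exact_mod_cast hj.ne'), div_eq_mul_inv]
  · filter_upwards with j using mul_one _

open Asymptotics Topology in
theorem nat_add_rpow_isBigO (a t : ℝ) :
    (fun j : ℕ => ((j : ℝ) + t) ^ a) =O[atTop] fun j : ℕ => (j : ℝ) ^ a := by
  have h1 := ((nat_add_rpow_sub_isLittleO a t).trans (nat_rpow_sub_one_isLittleO a)).isBigO
  have h2 := ((nat_rpow_sub_one_isLittleO a).const_mul_left (a * t)).isBigO
  refine ((h1.add h2).add (isBigO_refl _ _)).congr_left fun j => ?_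
  ring

theorem two_mul_add_rpow (a : ℝ) (j s : ℕ) :
    ((2 * j + s : ℕ) : ℝ) ^ a = 2 ^ a * ((j : ℝ) + s / 2) ^ a := by
  rw [← Real.mul_rpow (by norm_num) (by positivity)]
  congr 1
  push_cast
  ring

open Asymptotics Topology in
/-- Expansion of the reciprocal weights along an arithmetic progression of difference `2`. -/
theorem WeightAsymp.inv_isLittleO {w : ℕ → ℝ} {α B : ℝ} (hw : WeightAsymp w α B) (s : ℕ) :
    (fun j : ℕ => 1 / w (2 * j + s) - 2 ^ α * (j : ℝ) ^ α
        - 2 ^ α * (s * α / 2 + B) * (j : ℝ) ^ (α - 1))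
      =o[atTop] fun j : ℕ => (j : ℝ) ^ (α - 1) := by
  obtain ⟨C₀, hC₀, N₀, h⟩ := hw
  have hO : (fun j : ℕ => 1 / w (2 * j + s) - ((2 * j + s : ℕ) : ℝ) ^ α
      - 2 * B * ((2 * j + s : ℕ) : ℝ) ^ (α - 1)) =O[atTop]
        fun j : ℕ => ((2 * j + s : ℕ) : ℝ) ^ (α - 2) := by
    refine IsBigO.of_bound C₀ ?_
    filter_upwards [eventually_ge_atTop N₀] with j hj
    rw [Real.norm_eq_abs, Real.norm_of_nonneg (by positivity)]
    exact h _ (by omega)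
  simp_rw [two_mul_add_rpow] at hO
  have hlo : (fun j : ℕ => (j : ℝ) ^ (α - 2)) =o[atTop] fun j : ℕ => (j : ℝ) ^ (α - 1) := by
    have := nat_rpow_sub_one_isLittleO (α - 1)
    rwa [show α - 1 - 1 = α - 2 by ring] at this
  have h1 : (fun j : ℕ => 1 / w (2 * j + s) - 2 ^ α * ((j : ℝ) + s / 2) ^ α
      - 2 * B * (2 ^ (α - 1) * ((j : ℝ) + s / 2) ^ (α - 1))) =o[atTop]
        fun j : ℕ => (j : ℝ) ^ (α - 1) :=
    (hO.trans ((nat_add_rpow_isBigO (α - 2) (s / 2)).const_mul_left _)).trans_isLittleO hlo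
  have h2 := (nat_add_rpow_sub_isLittleO α (s / 2)).const_mul_left (2 ^ α)
  have h3 := ((((nat_add_rpow_sub_isLittleO (α - 1) (s / 2)).trans
    (nat_rpow_sub_one_isLittleO (α - 1))).add
    ((nat_rpow_sub_one_isLittleO (α - 1)).const_mul_left
      ((α - 1) * (s / 2)))).const_mul_left (2 ^ α * B))
  refine ((h1.add h2).add h3).congr_left fun j => ?_
  rw [Real.rpow_sub_one (show (2 : ℝ) ≠ 0 by norm_num)]
  ring

open Asymptotics Topology in
theorem WeightAsymp.inv_isLittleO_leading {w : ℕ → ℝ} {α B : ℝ} (hw : WeightAsymp w α B) (s : ℕ) :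
    (fun j : ℕ => 1 / w (2 * j + s) - 2 ^ α * (j : ℝ) ^ α) =o[atTop] fun j : ℕ => (j : ℝ) ^ α := by
  have h := nat_rpow_sub_one_isLittleO α
  refine (((hw.inv_isLittleO s).trans h).add
    (h.const_mul_left (2 ^ α * (s * α / 2 + B)))).congr_left fun j => ?_
  ring

open Asymptotics Topology in
/-- Euler–Maclaurin type expansion of the partial sums of the reciprocal weights. -/
theorem WeightAsymp.sum_inv_isLittleO {w : ℕ → ℝ} {α B : ℝ} (hα : 0 < α)
    (hw : WeightAsymp w α B) (s : ℕ) :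
    (fun k : ℕ => ∑ j ∈ Finset.range k, 1 / w (2 * j + s) - 2 ^ α / (α + 1) * (k : ℝ) ^ (α + 1)
        - 2 ^ α * (B / α + (s - 1) / 2) * (k : ℝ) ^ α)
      =o[atTop] fun k : ℕ => (k : ℝ) ^ α := by
  refine isLittleO_rpow_of_sub_isLittleO hα ?_
  have h1 := hw.inv_isLittleO s
  have h2 := (nat_succ_rpow_sub_isLittleO_sq (α + 1)).const_mul_left (2 ^ α / (α + 1))
  have h3 := (nat_add_rpow_sub_isLittleO α 1).const_mul_left (2 ^ α * (B / α + (s - 1) / 2))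
  rw [show α + 1 - 2 = α - 1 by ring] at h2
  refine ((h1.sub h2).sub h3).congr_left fun k => ?_
  rw [Finset.sum_range_succ, show α + 1 - 1 = α by ring]
  push_cast
  field_simp
  ring

theorem abs_rpow_sub_one_le_abs_rpow_sub_one {x a c : ℝ} (hx : 0 ≤ x) (ha : 0 < a) (hac : a ≤ c) :
    |x ^ a - 1| ≤ |x ^ c - 1| := by
  rcases le_total 1 x with h | h
  · have h1 : 1 ≤ x ^ a := Real.one_le_rpow h ha.le
    have h2 : x ^ a ≤ x ^ c := Real.rpow_le_rpow_of_exponent_le h hac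
    rw [abs_of_nonneg (by linarith), abs_of_nonneg (by linarith)]
    linarith
  · have h1 : x ^ a ≤ 1 := Real.rpow_le_one hx h ha.le
    have h2 : x ^ c ≤ x ^ a := by
      rcases hx.eq_or_lt with h0 | h0
      · rw [← h0, Real.zero_rpow ha.ne', Real.zero_rpow (by linarith)]
      · exact Real.rpow_le_rpow_of_exponent_ge h0 h hac
    rw [abs_of_nonpos (by linarith), abs_of_nonpos (by linarith)]
    linarith

/-- Global second order expansion of `x` in terms of `x ^ (α + 1) - 1`, with a quartic error. -/
theorem exists_abs_sub_one_sub_le {α : ℝ} (hα : 0 < α) {ε : ℝ} (hε : 0 < ε) :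
    ∃ C > 0, ∀ x v : ℝ, 0 ≤ x → v = x ^ (α + 1) - 1 →
      |x - 1 - 1 / (α + 1) * v + α / (2 * (α + 1) ^ 2) * v ^ 2| ≤ ε * v ^ 2 + C * v ^ 4 := by
  have h := (rpow_one_add_sub_isLittleO_sq (1 / (α + 1))).def hε
  obtain ⟨d, hd, h⟩ := Metric.eventually_nhds_iff.1 h
  refine ⟨2 / d ^ 3 + 1 / d ^ 2, by positivity, fun x v hx hv => ?_⟩
  have hxv : (1 + v) ^ (1 / (α + 1)) = x := by
    rw [hv, show 1 + (x ^ (α + 1) - 1) = x ^ (α + 1) by ring, ← Real.rpow_mul hx,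
      mul_one_div_cancel (by linarith), Real.rpow_one]
  have hv4 : v ^ 4 = |v| ^ 4 := by rw [← abs_pow, abs_of_nonneg (by positivity)]
  have hv2 : v ^ 2 = |v| ^ 2 := by rw [sq_abs]
  rcases lt_or_ge |v| d with hvd | hvd
  · have h1 := h (y := v) (by simpa [Real.dist_eq] using hvd)
    rw [hxv, Real.norm_eq_abs, Real.norm_of_nonneg (sq_nonneg v)] at h1
    have e : 1 / (α + 1) * (1 / (α + 1) - 1) / 2 = - (α / (2 * (α + 1) ^ 2)) := by
      field_simp
      ring
    rw [e] at h1
    have h2 : 0 ≤ (2 / d ^ 3 + 1 / d ^ 2) * v ^ 4 := by positivity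
    rw [show x - 1 - 1 / (α + 1) * v + α / (2 * (α + 1) ^ 2) * v ^ 2
      = x - 1 - 1 / (α + 1) * v - -(α / (2 * (α + 1) ^ 2)) * v ^ 2 by ring]
    linarith
  · have h1 : |x - 1| ≤ |v| := by
      have := abs_rpow_sub_one_le_abs_rpow_sub_one hx one_pos (by linarith : 1 ≤ α + 1)
      rwa [Real.rpow_one, ← hv] at this
    have hp : 1 / (α + 1) ≤ 1 := by
      rw [div_le_one (by linarith)]
      linarith
    have hp2 : α / (2 * (α + 1) ^ 2) ≤ 1 := by
      rw [div_le_one (by positivity)]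
      nlinarith
    have t1 : |1 / (α + 1) * v| ≤ |v| := by
      rw [abs_mul, abs_of_nonneg (by positivity : 0 ≤ 1 / (α + 1))]
      exact mul_le_of_le_one_left (abs_nonneg v) hp
    have t2 : |α / (2 * (α + 1) ^ 2) * v ^ 2| ≤ |v| ^ 2 := by
      rw [abs_mul, abs_of_nonneg (by positivity : 0 ≤ α / (2 * (α + 1) ^ 2)), abs_pow]
      exact mul_le_of_le_one_left (by positivity) hp2
    have t3 : |x - 1 - 1 / (α + 1) * v + α / (2 * (α + 1) ^ 2) * v ^ 2| ≤ 2 * |v| + |v| ^ 2 := by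
      calc _ ≤ |x - 1 - 1 / (α + 1) * v| + |α / (2 * (α + 1) ^ 2) * v ^ 2| := abs_add_le _ _
        _ ≤ |x - 1| + |1 / (α + 1) * v| + |α / (2 * (α + 1) ^ 2) * v ^ 2| := by
          gcongr
          exact abs_sub _ _
        _ ≤ _ := by linarith
    have hy : 1 ≤ |v| / d := (one_le_div hd).2 hvd
    have t4 : |v| ≤ |v| ^ 4 / d ^ 3 := by
      calc |v| = |v| * 1 ^ 3 := by ring
        _ ≤ |v| * (|v| / d) ^ 3 := by gcongr
        _ = _ := by ring
    have t5 : |v| ^ 2 ≤ |v| ^ 4 / d ^ 2 := by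
      calc |v| ^ 2 = |v| ^ 2 * 1 ^ 2 := by ring
        _ ≤ |v| ^ 2 * (|v| / d) ^ 2 := by gcongr
        _ = _ := by ring
    have t6 : 0 ≤ ε * v ^ 2 := by positivity
    calc _ ≤ 2 * |v| + |v| ^ 2 := t3
      _ ≤ 2 * (|v| ^ 4 / d ^ 3) + |v| ^ 4 / d ^ 2 := by linarith
      _ = (2 / d ^ 3 + 1 / d ^ 2) * v ^ 4 := by rw [hv4]; ring
      _ ≤ _ := by linarith

open Asymptotics in
theorem eventually_forall_abs_le_of_isLittleO {f : ℕ → ℝ} {a : ℝ} (ha : 0 < a)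
    (h : f =o[atTop] fun k : ℕ => (k : ℝ) ^ a) {ε : ℝ} (hε : 0 < ε) :
    ∀ᶠ N : ℕ in atTop, ∀ k : ℕ, |f k| ≤ ε * ((k : ℝ) ^ a + (N : ℝ) ^ a) := by
  obtain ⟨K, hK⟩ := eventually_atTop.1 (h.def hε)
  have htop : Tendsto (fun n : ℕ => ε * (n : ℝ) ^ a) atTop atTop :=
    ((tendsto_rpow_atTop ha).comp tendsto_natCast_atTop_atTop).const_mul_atTop hε
  filter_upwards [htop.eventually_ge_atTop (∑ i ∈ Finset.range K, |f i|)] with N hN k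
  have p1 : 0 ≤ ε * (k : ℝ) ^ a := by positivity
  have p2 : 0 ≤ ε * (N : ℝ) ^ a := by positivity
  rw [mul_add]
  rcases lt_or_ge k K with hk | hk
  · have := Finset.single_le_sum (f := fun i => |f i|) (fun i _ => abs_nonneg _)
      (Finset.mem_range.2 hk)
    linarith
  · have := hK k hk
    rw [Real.norm_eq_abs, Real.norm_of_nonneg (by positivity)] at this
    linarith

/-- The relative deviation `(k / N) ^ (α + 1) - 1`. -/
noncomputable def relDev (α : ℝ) (N k : ℕ) : ℝ := ((k : ℝ) / N) ^ (α + 1) - 1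

/-- The difference `Φ k - A N` on its natural scale `N ^ (α + 1)`. -/
noncomputable def scaledDiff (α : ℝ) (Φ A : ℕ → ℝ) (N k : ℕ) : ℝ :=
  (Φ k - A N) / (N : ℝ) ^ (α + 1)

theorem abs_div_rpow_sub_one_le_relDev {α : ℝ} (hα : 0 < α) (N k : ℕ) :
    |((k : ℝ) / N) ^ α - 1| ≤ |relDev α N k| :=
  abs_rpow_sub_one_le_abs_rpow_sub_one (by positivity) hα (by linarith)

theorem natCast_rpow_eq {N : ℕ} (hN : 0 < N) (k : ℕ) (a : ℝ) :
    (k : ℝ) ^ a = ((k : ℝ) / N) ^ a * (N : ℝ) ^ a := by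
  rw [← Real.mul_rpow (by positivity) (by positivity), div_mul_cancel₀ _ (by positivity)]

theorem natCast_rpow_le_relDev {α : ℝ} (hα : 0 < α) {N : ℕ} (hN : 0 < N) (k : ℕ) :
    (k : ℝ) ^ α ≤ (1 + |relDev α N k|) * (N : ℝ) ^ α := by
  rw [natCast_rpow_eq hN k]
  have := (abs_le.1 (abs_div_rpow_sub_one_le_relDev hα N k)).2
  gcongr
  linarith

open Asymptotics in
theorem eventually_abs_scaledDiff_sub_le {α g γ δ : ℝ} (hα : 0 < α) {Φ A : ℕ → ℝ}
    (hΦ : (fun k => Φ k - g * (k : ℝ) ^ (α + 1) - γ * (k : ℝ) ^ α)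
      =o[atTop] fun k : ℕ => (k : ℝ) ^ α)
    (hA : (fun k => A k - g * (k : ℝ) ^ (α + 1) - (γ - δ) * (k : ℝ) ^ α)
      =o[atTop] fun k : ℕ => (k : ℝ) ^ α) {ε : ℝ} (hε : 0 < ε) :
    ∀ᶠ N : ℕ in atTop, ∀ k : ℕ, |scaledDiff α Φ A N k - g * relDev α N k - δ / N|
      ≤ (|γ| * |relDev α N k| + ε * (1 + |relDev α N k|)) / N := by
  filter_upwards [eventually_gt_atTop 0,
    eventually_forall_abs_le_of_isLittleO hα hΦ (show 0 < ε / 4 by positivity),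
    eventually_forall_abs_le_of_isLittleO hα hA (show 0 < ε / 4 by positivity)]
    with N hN h1 h2 k
  have hN' : (0 : ℝ) < N := by exact_mod_cast hN
  have hx := abs_div_rpow_sub_one_le_relDev hα N k
  have h1 := h1 k
  have h2 := h2 N
  set v := relDev α N k with hv
  have hk1 : (k : ℝ) ^ (α + 1) = (v + 1) * ((N : ℝ) ^ α * N) := by
    rw [natCast_rpow_eq hN k, hv, relDev, sub_add_cancel, Real.rpow_add_one hN'.ne']
  have hk0 := natCast_rpow_eq hN k α
  set x := ((k : ℝ) / N) ^ α with hxdef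
  set P := (N : ℝ) ^ α with hP
  have hPpos : 0 < P := by positivity
  have hN1 : (N : ℝ) ^ (α + 1) = P * N := by rw [Real.rpow_add_one hN'.ne']
  rw [hk1, hk0] at h1
  rw [hN1] at h2
  rw [scaledDiff, hN1]
  have e : (Φ k - A N) / (P * N) - g * v - δ / N
      = ((Φ k - g * ((v + 1) * (P * N)) - γ * (x * P)) - (A N - g * (P * N) - (γ - δ) * P)
        + γ * (x - 1) * P) / (P * N) := by
    field_simp
    ring
  rw [e, abs_div, abs_of_pos (by positivity : 0 < P * N), div_le_div_iff₀ (by positivity) hN']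
  have hx2 := (abs_le.1 hx).2
  have t1 : |γ * (x - 1) * P| ≤ |γ| * |v| * P := by
    rw [abs_mul, abs_mul, abs_of_pos hPpos]
    gcongr
  have t2 : ε / 4 * (x * P + P) ≤ ε / 4 * ((1 + |v|) * P + P) := by
    gcongr
    linarith
  have t3 : |Φ k - g * ((v + 1) * (P * N)) - γ * (x * P) - (A N - g * (P * N) - (γ - δ) * P)
        + γ * (x - 1) * P| ≤ ε / 4 * ((1 + |v|) * P + P) + ε / 4 * (P + P) + |γ| * |v| * P := by
    refine (abs_add_le _ _).trans (add_le_add ((abs_sub _ _).trans (add_le_add ?_ h2)) t1)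
    exact h1.trans t2
  have t4 : 0 ≤ ε * (|v| * P) := by positivity
  calc _ ≤ (ε / 4 * ((1 + |v|) * P + P) + ε / 4 * (P + P) + |γ| * |v| * P) * N := by gcongr
    _ ≤ ((|γ| * |v| + ε * (1 + |v|)) * P) * N := by
      gcongr
      linarith
    _ = _ := by ring

/-- The hypothesis is the conclusion of `eventually_abs_scaledDiff_sub_le`. -/
theorem exists_eventually_abs_relDev_le {α g γ δ : ℝ} (hg : 0 < g) {Φ A : ℕ → ℝ}
    (h : ∀ᶠ N : ℕ in atTop, ∀ k : ℕ, |scaledDiff α Φ A N k - g * relDev α N k - δ / N|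
      ≤ (|γ| * |relDev α N k| + 1 * (1 + |relDev α N k|)) / N) :
    ∃ C > 0, ∀ᶠ N : ℕ in atTop, ∀ k : ℕ,
      |relDev α N k| ≤ C * (|scaledDiff α Φ A N k| + 1 / N) := by
  refine ⟨2 / g * (1 + |δ|), by positivity, ?_⟩
  filter_upwards [h, eventually_gt_atTop 0,
    tendsto_natCast_atTop_atTop.eventually_ge_atTop (2 * (|γ| + 1) / g)] with N h hN hN2 k
  have h := h k
  have hN' : (0 : ℝ) < N := by exact_mod_cast hN
  set v := relDev α N k
  set m := scaledDiff α Φ A N k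
  have h1 : g * |v| ≤ |m| + |δ| / N + (|γ| * |v| + 1 * (1 + |v|)) / N := by
    calc g * |v| = |g * v| := by rw [abs_mul, abs_of_pos hg]
      _ = |m - δ / N - (m - g * v - δ / N)| := by congr 1; ring
      _ ≤ |m - δ / N| + |m - g * v - δ / N| := abs_sub _ _
      _ ≤ |m| + |δ / N| + |m - g * v - δ / N| := by gcongr; exact abs_sub _ _
      _ ≤ _ := by rw [abs_div, Nat.abs_cast]; gcongr
  have h2 : (|γ| + 1) * |v| / N ≤ g / 2 * |v| := by
    rw [div_le_iff₀ hN']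
    rw [div_le_iff₀ hg] at hN2
    nlinarith [abs_nonneg v]
  have h3 : (|γ| * |v| + 1 * (1 + |v|)) / N = (|γ| + 1) * |v| / N + 1 / N := by ring
  have h4 : g / 2 * |v| ≤ |m| + (1 + |δ|) * (1 / N) := by
    have : (1 + |δ|) * (1 / N) = 1 / N + |δ| / N := by ring
    linarith
  have h5 : 0 ≤ |δ| * |m| := by positivity
  calc |v| = 2 / g * (g / 2 * |v|) := by field_simp
    _ ≤ 2 / g * (|m| + (1 + |δ|) * (1 / N)) := by gcongr
    _ ≤ 2 / g * ((1 + |δ|) * (|m| + 1 / N)) := by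
      gcongr
      linarith
    _ = _ := by ring

theorem abs_expansion_le {g δ p c Γ ε₁ ε₂ C₂ n x m v : ℝ} (hg : 0 < g) (hp : 0 < p) (hc : 0 < c)
    (hΓ : 0 ≤ Γ) (hε₁' : ε₁ ≤ 1) (hn : 0 < n)
    (h : |m - g * v - δ / n| ≤ (Γ * |v| + ε₁) / n)
    (hT : |x - 1 - p * v + c * v ^ 2| ≤ ε₂ * v ^ 2 + C₂ * v ^ 4) :
    |(x * n - n) - n * (p / g) * m + δ * (p / g) + c / g ^ 2 * (n * m ^ 2)|
      ≤ n * (ε₂ * v ^ 2 + C₂ * v ^ 4) + p / g * ε₁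
        + (p / g * Γ + c / g ^ 2 * (|δ| + 1 + Γ) * (1 + g)) *
          ((|m| + |v|) + (|m| + |v|) ^ 2) := by
  have hm0 : 0 ≤ |m| := abs_nonneg _
  have hv0 : 0 ≤ |v| := abs_nonneg _
  have hδ0 : 0 ≤ |δ| := abs_nonneg _
  have e2 : |m - g * v| ≤ (|δ| + 1 + Γ * |v|) / n := by
    calc |m - g * v| = |(m - g * v - δ / n) + δ / n| := by congr 1; ring
      _ ≤ |m - g * v - δ / n| + |δ / n| := abs_add_le _ _
      _ ≤ (Γ * |v| + ε₁) / n + |δ| / n := by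
        rw [abs_div, abs_of_pos hn]
        gcongr
      _ = (|δ| + ε₁ + Γ * |v|) / n := by ring
      _ ≤ _ := by gcongr
  have e3 : |m ^ 2 - g ^ 2 * v ^ 2| ≤ (|δ| + 1 + Γ * |v|) / n * (|m| + g * |v|) := by
    rw [show m ^ 2 - g ^ 2 * v ^ 2 = (m - g * v) * (m + g * v) by ring, abs_mul]
    have : |m + g * v| ≤ |m| + g * |v| := by
      refine (abs_add_le _ _).trans ?_
      rw [abs_mul, abs_of_pos hg]
    gcongr
  have e4 : |(x * n - n) - n * (p / g) * m + δ * (p / g) + c / g ^ 2 * (n * m ^ 2)|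
      ≤ n * (ε₂ * v ^ 2 + C₂ * v ^ 4) + n * (p / g) * ((Γ * |v| + ε₁) / n)
        + c * n / g ^ 2 * ((|δ| + 1 + Γ * |v|) / n * (|m| + g * |v|)) := by
    have : (x * n - n) - n * (p / g) * m + δ * (p / g) + c / g ^ 2 * (n * m ^ 2)
      = n * (x - 1 - p * v + c * v ^ 2) - n * (p / g) * (m - g * v - δ / n)
        + c * n / g ^ 2 * (m ^ 2 - g ^ 2 * v ^ 2) := by
      field_simp
      ring
    rw [this]
    refine (abs_add_le _ _).trans (add_le_add ((abs_sub _ _).trans (add_le_add ?_ ?_)) ?_)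
    · rw [abs_mul, abs_of_pos hn]
      exact mul_le_mul_of_nonneg_left hT hn.le
    · rw [abs_mul, abs_of_pos (by positivity : 0 < n * (p / g))]
      exact mul_le_mul_of_nonneg_left h (by positivity)
    · rw [abs_mul, abs_of_pos (by positivity : 0 < c * n / g ^ 2)]
      exact mul_le_mul_of_nonneg_left e3 (by positivity)
  have e5 : n * (p / g) * ((Γ * |v| + ε₁) / n)
        + c * n / g ^ 2 * ((|δ| + 1 + Γ * |v|) / n * (|m| + g * |v|))
      = p / g * ε₁ + p / g * Γ * |v|
        + c / g ^ 2 * ((|δ| + 1 + Γ * |v|) * (|m| + g * |v|)) := by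
    field_simp
    ring
  obtain ⟨s, hs⟩ : ∃ s, s = |m| + |v| := ⟨_, rfl⟩
  have hs0 : 0 ≤ s := by linarith
  have hvs : |v| ≤ s := by linarith
  have u1 := mul_le_mul_of_nonneg_left hvs hΓ
  have u2 := mul_le_mul_of_nonneg_left hvs hg.le
  have u3 := mul_nonneg hδ0 hs0
  have u7 := mul_nonneg hg.le hm0
  have u4 : |v| ≤ s + s ^ 2 := by linarith [sq_nonneg s]
  have u5 : |δ| + 1 + Γ * |v| ≤ (|δ| + 1 + Γ) * (1 + s) := by linarith
  have u6 : |m| + g * |v| ≤ (1 + g) * s := by linarith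
  have e6 : p / g * Γ * |v| + c / g ^ 2 * ((|δ| + 1 + Γ * |v|) * (|m| + g * |v|))
      ≤ (p / g * Γ + c / g ^ 2 * (|δ| + 1 + Γ) * (1 + g)) * (s + s ^ 2) := by
    calc _ ≤ p / g * Γ * (s + s ^ 2)
          + c / g ^ 2 * (((|δ| + 1 + Γ) * (1 + s)) * ((1 + g) * s)) := by gcongr
      _ = _ := by ring
  rw [← hs]
  linarith

theorem expansion_error_le {ε K K₁ L C₂ n a v : ℝ} (hε : 0 < ε) (hK : 0 < K) (hK₁ : 0 < K₁)
    (hL : L = 2 * (K + 1) ^ 2 * K₁) (hC₂ : 0 < C₂) (ha : 0 ≤ a) (hv : 0 ≤ v) (hn : 1 ≤ n)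
    (hvK : v ≤ K * (a + 1 / n)) (hna : 64 * L ^ 2 ≤ n * ε ^ 2) (hnb : 16 * L ≤ n * ε)
    (hnc : 64 * C₂ * K ^ 4 ≤ n * ε) :
    n * (ε / (8 * K ^ 2) * v ^ 2 + C₂ * v ^ 4) + K₁ * ((a + v) + (a + v) ^ 2)
      ≤ 3 / 4 * ε + ε / 2 * (n * a ^ 2) + 8 * C₂ * K ^ 4 * (n * a ^ 4) := by
  have hn0 : 0 < n := by linarith
  have hL0 : 0 < L := by rw [hL]; positivity
  have hinv1 : 1 / n ≤ 1 := by rw [div_le_one hn0]; exact hn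
  have hinv0 : 0 < 1 / n := by positivity
  have hinv2 : (1 / n) ^ 2 ≤ 1 / n := pow_le_of_le_one hinv0.le hinv1 two_ne_zero
  obtain ⟨s, hs⟩ : ∃ s, s = a + v := ⟨_, rfl⟩
  obtain ⟨y, hy⟩ : ∃ y, y = 1 / n := ⟨_, rfl⟩
  have hny : n * y = 1 := by rw [hy]; field_simp
  rw [← hy] at hinv0 hinv1 hinv2 hvK
  rw [← hs]
  have hs0 : 0 ≤ s := by linarith
  have sq2 : ∀ y z : ℝ, (y + z) ^ 2 ≤ 2 * (y ^ 2 + z ^ 2) := fun y z => by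
    linarith [sq_nonneg (y - z)]
  have hsL : s ≤ (K + 1) * (a + y) := by linarith
  have e7 : s ^ 2 ≤ 2 * (K + 1) ^ 2 * (a ^ 2 + y) := by
    calc s ^ 2 ≤ ((K + 1) * (a + y)) ^ 2 := by gcongr
      _ = (K + 1) ^ 2 * (a + y) ^ 2 := by ring
      _ ≤ (K + 1) ^ 2 * (2 * (a ^ 2 + y)) := by
        gcongr
        linarith [sq2 a y]
      _ = _ := by ring
  have e8 : s ≤ 2 * (K + 1) ^ 2 * (a + y) := by
    have : K + 1 ≤ 2 * (K + 1) ^ 2 := by linarith [sq_nonneg K]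
    exact hsL.trans (mul_le_mul_of_nonneg_right this (by positivity))
  have e9 : K₁ * (s + s ^ 2) ≤ L * (a + a ^ 2 + 2 * y) := by
    calc _ ≤ K₁ * (2 * (K + 1) ^ 2 * (a + y) + 2 * (K + 1) ^ 2 * (a ^ 2 + y)) := by gcongr
      _ = _ := by rw [hL]; ring
  have e10 : v ^ 2 ≤ 2 * K ^ 2 * (a ^ 2 + y ^ 2) := by
    calc v ^ 2 ≤ (K * (a + y)) ^ 2 := by gcongr
      _ = K ^ 2 * (a + y) ^ 2 := by ring
      _ ≤ K ^ 2 * (2 * (a ^ 2 + y ^ 2)) := by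
        gcongr
        exact sq2 a y
      _ = _ := by ring
  have e11 : v ^ 4 ≤ 8 * K ^ 4 * (a ^ 4 + y ^ 4) := by
    calc v ^ 4 = (v ^ 2) ^ 2 := by ring
      _ ≤ (2 * K ^ 2 * (a ^ 2 + y ^ 2)) ^ 2 := by gcongr
      _ = 4 * K ^ 4 * (a ^ 2 + y ^ 2) ^ 2 := by ring
      _ ≤ 4 * K ^ 4 * (2 * ((a ^ 2) ^ 2 + (y ^ 2) ^ 2)) := by
        gcongr
        exact sq2 _ _
      _ = _ := by ring
  have e12 : n * (ε / (8 * K ^ 2) * v ^ 2 + C₂ * v ^ 4)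
      ≤ ε / 4 * (n * a ^ 2) + ε / 4 + 8 * C₂ * K ^ 4 * (n * a ^ 4) + ε / 8 := by
    have t1 : n * (ε / (8 * K ^ 2) * (2 * K ^ 2 * (a ^ 2 + y ^ 2)))
        = ε / 4 * (n * a ^ 2) + ε / 4 * (n * y * y) := by field_simp; ring
    have t2 : n * (C₂ * (8 * K ^ 4 * (a ^ 4 + y ^ 4)))
        = 8 * C₂ * K ^ 4 * (n * a ^ 4) + 8 * C₂ * K ^ 4 * y ^ 2 * (n * y * y) := by
      ring
    rw [hny, one_mul] at t1 t2
    have t3 : 8 * C₂ * K ^ 4 * y ^ 2 * y ≤ ε / 8 := by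
      have u1 : y ^ 2 ≤ 1 := hinv2.trans hinv1
      calc 8 * C₂ * K ^ 4 * y ^ 2 * y ≤ 8 * C₂ * K ^ 4 * 1 * y := by gcongr
        _ = (64 * C₂ * K ^ 4) * y / 8 := by ring
        _ ≤ (n * ε) * y / 8 := by gcongr
        _ = ε * (n * y) / 8 := by ring
        _ = ε / 8 := by rw [hny, mul_one]
    have t4 : ε / 4 * y ≤ ε / 4 := mul_le_of_le_one_right (by positivity) hinv1
    calc _ ≤ n * (ε / (8 * K ^ 2) * (2 * K ^ 2 * (a ^ 2 + y ^ 2))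
          + C₂ * (8 * K ^ 4 * (a ^ 4 + y ^ 4))) := by gcongr
      _ ≤ _ := by rw [mul_add, t1, t2]; linarith
  have e13 : L * a ≤ ε / 8 + ε / 8 * (n * a ^ 2) := by
    have u1 : L * a ≤ ε / 8 + 2 * L ^ 2 / ε * a ^ 2 := by
      have : 0 ≤ (ε / 8) * (1 - 4 * L / ε * a) ^ 2 := by positivity
      have e : (ε / 8) * (1 - 4 * L / ε * a) ^ 2 = ε / 8 - L * a + 2 * L ^ 2 / ε * a ^ 2 := by
        field_simp
        ring
      linarith
    have u2 : 2 * L ^ 2 / ε ≤ ε / 8 * n := by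
      rw [div_le_iff₀ hε]
      linarith [sq_nonneg L]
    calc _ ≤ ε / 8 + 2 * L ^ 2 / ε * a ^ 2 := u1
      _ ≤ ε / 8 + ε / 8 * n * a ^ 2 := by gcongr
      _ = _ := by ring
  have e14 : L * a ^ 2 ≤ ε / 8 * (n * a ^ 2) := by
    have : L ≤ ε / 8 * n := by linarith
    calc L * a ^ 2 ≤ ε / 8 * n * a ^ 2 := by gcongr
      _ = _ := by ring
  have e15 : L * (2 * y) ≤ ε / 8 := by
    calc L * (2 * y) = (16 * L) * y / 8 := by ring
      _ ≤ n * ε * y / 8 := by gcongr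
      _ = ε * (n * y) / 8 := by ring
      _ = ε / 8 := by rw [hny, mul_one]
  linarith

/-- Second order expansion of the displacement `k - N` in terms of the scaled difference. -/
theorem exists_eventually_abs_displacement_sub_le {α g γ δ : ℝ} (hα : 0 < α) (hg : 0 < g)
    {Φ A : ℕ → ℝ}
    (h : ∀ ε > 0, ∀ᶠ N : ℕ in atTop, ∀ k : ℕ, |scaledDiff α Φ A N k - g * relDev α N k - δ / N|
      ≤ (|γ| * |relDev α N k| + ε * (1 + |relDev α N k|)) / N) {ε : ℝ} (hε : 0 < ε) :
    ∃ C > 0, ∀ᶠ N : ℕ in atTop, ∀ k : ℕ,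
      |((k : ℝ) - N) - N * (1 / (α + 1) / g) * scaledDiff α Φ A N k + δ * (1 / (α + 1) / g)
          + α / (2 * (α + 1) ^ 2) / g ^ 2 * (N * scaledDiff α Φ A N k ^ 2)|
        ≤ ε * (1 + N * scaledDiff α Φ A N k ^ 2) + C * (N * scaledDiff α Φ A N k ^ 4) := by
  obtain ⟨K, hK, hKv⟩ := exists_eventually_abs_relDev_le hg (h 1 one_pos)
  have hp0 : 0 < 1 / (α + 1) := by positivity
  have hc0 : 0 < α / (2 * (α + 1) ^ 2) := by positivity
  obtain ⟨K₁, hK₁⟩ : ∃ K₁, K₁ = 1 / (α + 1) / g * (|γ| + 1)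
    + α / (2 * (α + 1) ^ 2) / g ^ 2 * (|δ| + 1 + (|γ| + 1)) * (1 + g) := ⟨_, rfl⟩
  have hK₁0 : 0 < K₁ := by rw [hK₁]; positivity
  obtain ⟨L, hL⟩ : ∃ L, L = 2 * (K + 1) ^ 2 * K₁ := ⟨_, rfl⟩
  obtain ⟨C₂, hC₂, hT⟩ := exists_abs_sub_one_sub_le hα (show 0 < ε / (8 * K ^ 2) by positivity)
  obtain ⟨ε₁, hε₁, hε₁1, hε₁2⟩ : ∃ ε₁ > 0, ε₁ ≤ 1 ∧ 1 / (α + 1) / g * ε₁ ≤ ε / 8 := by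
    refine ⟨min 1 (ε / 8 / (1 / (α + 1) / g)), lt_min one_pos (by positivity), min_le_left _ _, ?_⟩
    rw [← le_div_iff₀' (by positivity)]
    exact min_le_right _ _
  refine ⟨8 * C₂ * K ^ 4, by positivity, ?_⟩
  have hN := tendsto_natCast_atTop_atTop (R := ℝ)
  filter_upwards [h _ hε₁, hKv, eventually_ge_atTop 1,
    hN.eventually_ge_atTop (64 * L ^ 2 / ε ^ 2), hN.eventually_ge_atTop (16 * L / ε),
    hN.eventually_ge_atTop (64 * C₂ * K ^ 4 / ε)] with N h hKv hN1 hNa hNb hNc k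
  have h := h k
  have hKv := hKv k
  have hn1 : (1 : ℝ) ≤ N := by exact_mod_cast hN1
  have hn0 : (0 : ℝ) < N := by linarith
  have hT := hT ((k : ℝ) / N) (relDev α N k) (by positivity) rfl
  rw [div_le_iff₀ (by positivity)] at hNa hNb hNc
  have hx : (k : ℝ) = (k : ℝ) / N * N := by field_simp
  have h' : |scaledDiff α Φ A N k - g * relDev α N k - δ / N|
      ≤ ((|γ| + 1) * |relDev α N k| + ε₁) / N := by
    refine h.trans (div_le_div_of_nonneg_right ?_ hn0.le)
    have := mul_le_of_le_one_left (abs_nonneg (relDev α N k)) hε₁1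
    linarith
  have b1 := abs_expansion_le hg hp0 hc0 (by positivity) hε₁1 hn0 h' hT
  rw [← hK₁, ← hx] at b1
  have b2 := expansion_error_le hε hK hK₁0 hL hC₂ (abs_nonneg _) (abs_nonneg _) hn1 hKv hNa hNb hNc
  have q2 : |relDev α N k| ^ 2 = relDev α N k ^ 2 := sq_abs _
  have q4 : |relDev α N k| ^ 4 = relDev α N k ^ 4 := Even.pow_abs (by decide) _
  have q2' : |scaledDiff α Φ A N k| ^ 2 = scaledDiff α Φ A N k ^ 2 := sq_abs _
  have q4' : |scaledDiff α Φ A N k| ^ 4 = scaledDiff α Φ A N k ^ 4 := Even.pow_abs (by decide) _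
  rw [q2, q4, q2', q4'] at b2
  have b3 : 0 ≤ ε * (N * scaledDiff α Φ A N k ^ 2) := by positivity
  refine b1.trans ?_
  linarith

open Asymptotics in
theorem exists_eventually_abs_le_mul_one_add {α c K : ℝ} (hα : 0 < α) (hc : 0 < c) {Φ A q : ℕ → ℝ}
    (hq : (fun k => q k - c * (k : ℝ) ^ α) =o[atTop] fun k : ℕ => (k : ℝ) ^ α) (hK : 0 < K)
    (hV : ∀ᶠ N : ℕ in atTop, ∀ k : ℕ,
      |relDev α N k| ≤ K * (|scaledDiff α Φ A N k| + 1 / N)) :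
    ∃ C > 0, ∀ᶠ N : ℕ in atTop, ∀ k : ℕ,
      |q k| ≤ C * (N : ℝ) ^ α * (1 + |scaledDiff α Φ A N k|) := by
  refine ⟨(c + 1) * (K + 1) + 1, by positivity, ?_⟩
  filter_upwards [eventually_forall_abs_le_of_isLittleO hα hq one_pos, hV,
    eventually_ge_atTop 1] with N h1 h2 hN k
  have hn1 : (1 : ℝ) ≤ N := by exact_mod_cast hN
  have hinv1 : 1 / (N : ℝ) ≤ 1 := by rw [div_le_one (by linarith)]; exact hn1
  have h1 := h1 k
  have h2 := h2 k
  have h3 := natCast_rpow_le_relDev hα hN k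
  obtain ⟨P, hP⟩ : ∃ P, P = (N : ℝ) ^ α := ⟨_, rfl⟩
  have hP0 : 0 ≤ P := by rw [hP]; positivity
  rw [← hP] at h1 h3 ⊢
  have hm0 := abs_nonneg (scaledDiff α Φ A N k)
  have h4 : |relDev α N k| ≤ K * (|scaledDiff α Φ A N k| + 1) := h2.trans (by gcongr)
  calc |q k| = |(q k - c * (k : ℝ) ^ α) + c * (k : ℝ) ^ α| := by congr 1; ring
    _ ≤ 1 * ((k : ℝ) ^ α + P) + c * (k : ℝ) ^ α := by
      refine (abs_add_le _ _).trans (add_le_add h1 ?_)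
      rw [abs_of_nonneg (by positivity)]
    _ = (c + 1) * (k : ℝ) ^ α + P := by ring
    _ ≤ (c + 1) * ((1 + |relDev α N k|) * P) + P := by gcongr
    _ ≤ (c + 1) * ((1 + K * (|scaledDiff α Φ A N k| + 1)) * P) + P := by gcongr
    _ ≤ (c + 1) * ((K + 1) * (1 + |scaledDiff α Φ A N k|) * P)
        + (1 + |scaledDiff α Φ A N k|) * P := by
      gcongr
      · linarith
      · exact le_mul_of_one_le_left hP0 (by linarith)
    _ = _ := by ring

open Asymptotics in
theorem exists_eventually_abs_sub_le_sq {α c K : ℝ} (hα : 0 < α) (hc : 0 < c) {Φ A q : ℕ → ℝ}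
    (hq : (fun k => q k - c * (k : ℝ) ^ α) =o[atTop] fun k : ℕ => (k : ℝ) ^ α) (hK : 0 < K)
    (hV : ∀ᶠ N : ℕ in atTop, ∀ k : ℕ,
      |relDev α N k| ≤ K * (|scaledDiff α Φ A N k| + 1 / N)) {ε : ℝ} (hε : 0 < ε) :
    ∃ C > 0, ∀ᶠ N : ℕ in atTop, ∀ k : ℕ,
      |q k - c * (N : ℝ) ^ α| ≤ (N : ℝ) ^ α * (ε + C * scaledDiff α Φ A N k ^ 2) := by
  obtain ⟨L, hL⟩ : ∃ L, L = (c + 1) * K := ⟨_, rfl⟩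
  have hL0 : 0 < L := by rw [hL]; positivity
  obtain ⟨ε₁, hε₁, hε₁1, hε₁2⟩ : ∃ ε₁ > 0, ε₁ ≤ 1 ∧ ε₁ ≤ ε / 6 :=
    ⟨min 1 (ε / 6), lt_min one_pos (by positivity), min_le_left _ _, min_le_right _ _⟩
  refine ⟨L ^ 2 / ε, by positivity, ?_⟩
  filter_upwards [eventually_forall_abs_le_of_isLittleO hα hq hε₁, hV,
    eventually_gt_atTop 0,
    tendsto_natCast_atTop_atTop.eventually_ge_atTop (3 * L / ε)] with N h1 h2 hN hN2 k
  have hn : (0 : ℝ) < N := by exact_mod_cast hN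
  have h1 := h1 k
  have h2 := h2 k
  have hk := natCast_rpow_eq hN k α
  have hx := abs_div_rpow_sub_one_le_relDev hα N k
  have hx2 := (abs_le.1 hx).2
  obtain ⟨P, hP⟩ : ∃ P, P = (N : ℝ) ^ α := ⟨_, rfl⟩
  have hP0 : 0 ≤ P := by rw [hP]; positivity
  rw [hk, ← hP] at h1
  rw [← hP]
  obtain ⟨x, hxx⟩ : ∃ x, x = ((k : ℝ) / N) ^ α := ⟨_, rfl⟩
  rw [← hxx] at h1 hx hx2
  obtain ⟨a, ha⟩ : ∃ a, a = |scaledDiff α Φ A N k| := ⟨_, rfl⟩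
  rw [← ha] at h2
  rw [← sq_abs (scaledDiff α Φ A N k), ← ha]
  have h3 : |q k - c * P| ≤ P * (c * |relDev α N k| + ε₁ * (2 + |relDev α N k|)) := by
    calc |q k - c * P| = |(q k - c * (x * P)) + c * P * (x - 1)| := by congr 1; ring
      _ ≤ ε₁ * (x * P + P) + c * P * |relDev α N k| := by
        refine (abs_add_le _ _).trans (add_le_add h1 ?_)
        rw [abs_mul, abs_of_nonneg (by positivity : 0 ≤ c * P)]
        gcongr
      _ ≤ ε₁ * ((1 + |relDev α N k|) * P + P) + c * P * |relDev α N k| := by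
        gcongr
        linarith
      _ = _ := by ring
  refine h3.trans (mul_le_mul_of_nonneg_left ?_ hP0)
  have h4 : ε₁ * |relDev α N k| ≤ |relDev α N k| :=
    mul_le_of_le_one_left (abs_nonneg _) hε₁1
  have h5 : (c + 1) * |relDev α N k| ≤ L * a + L / N := by
    calc _ ≤ (c + 1) * (K * (a + 1 / N)) := by gcongr
      _ = _ := by rw [hL]; ring
  have h6 : L / N ≤ ε / 3 := by
    rw [div_le_iff₀ hε] at hN2
    rw [div_le_iff₀ hn]
    linarith
  have h7 : L * a ≤ ε / 4 + L ^ 2 / ε * a ^ 2 := by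
    have : 0 ≤ (ε / 4) * (1 - 2 * L / ε * a) ^ 2 := by positivity
    have e : (ε / 4) * (1 - 2 * L / ε * a) ^ 2 = ε / 4 - L * a + L ^ 2 / ε * a ^ 2 := by
      field_simp
      ring
    linarith
  linarith

/-- A function on `ℕ` of at most polynomial growth. -/
def PolyBdd (f : ℕ → ℝ) : Prop := ∃ C : ℝ, ∃ p : ℕ, ∀ k : ℕ, |f k| ≤ C * ((k : ℝ) + 1) ^ p

namespace PolyBdd

theorem nonneg_const {f : ℕ → ℝ} {C : ℝ} {p : ℕ} (h : ∀ k : ℕ, |f k| ≤ C * ((k : ℝ) + 1) ^ p) :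
    0 ≤ C := by
  have := (abs_nonneg _).trans (h 0)
  simpa using this

theorem const (c : ℝ) : PolyBdd fun _ => c := ⟨|c|, 0, fun k => by simp⟩

theorem natCast : PolyBdd fun k => (k : ℝ) :=
  ⟨1, 1, fun k => by rw [abs_of_nonneg (by positivity)]; linarith⟩

theorem add {f g : ℕ → ℝ} (hf : PolyBdd f) (hg : PolyBdd g) : PolyBdd fun k => f k + g k := by
  obtain ⟨C, p, hf⟩ := hf
  obtain ⟨D, s, hg⟩ := hg
  have hC := nonneg_const hf
  have hD := nonneg_const hg
  refine ⟨C + D, p + s, fun k => ?_⟩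
  have h1 : (1 : ℝ) ≤ k + 1 := by linarith [Nat.cast_nonneg (α := ℝ) k]
  calc |f k + g k| ≤ |f k| + |g k| := abs_add_le _ _
    _ ≤ C * ((k : ℝ) + 1) ^ p + D * ((k : ℝ) + 1) ^ s := add_le_add (hf k) (hg k)
    _ ≤ C * ((k : ℝ) + 1) ^ (p + s) + D * ((k : ℝ) + 1) ^ (p + s) := by
      gcongr <;> first | exact h1 | omega
    _ = _ := by ring

theorem mul {f g : ℕ → ℝ} (hf : PolyBdd f) (hg : PolyBdd g) : PolyBdd fun k => f k * g k := by
  obtain ⟨C, p, hf⟩ := hf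
  obtain ⟨D, s, hg⟩ := hg
  have hC := nonneg_const hf
  refine ⟨C * D, p + s, fun k => ?_⟩
  calc |f k * g k| = |f k| * |g k| := abs_mul _ _
    _ ≤ (C * ((k : ℝ) + 1) ^ p) * (D * ((k : ℝ) + 1) ^ s) := by
      gcongr
      · exact hf k
      · exact hg k
    _ = _ := by ring

theorem const_mul (c : ℝ) {f : ℕ → ℝ} (hf : PolyBdd f) : PolyBdd fun k => c * f k :=
  (const c).mul hf

theorem sub {f g : ℕ → ℝ} (hf : PolyBdd f) (hg : PolyBdd g) : PolyBdd fun k => f k - g k := by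
  refine (funext fun k => ?_ : (fun k => f k + -1 * g k) = fun k => f k - g k) ▸
    hf.add (hg.const_mul (-1))
  ring

theorem pow {f : ℕ → ℝ} (hf : PolyBdd f) (s : ℕ) : PolyBdd fun k => f k ^ s := by
  induction s with
  | zero => simpa using const 1
  | succ s ih => simpa only [pow_succ] using ih.mul hf

theorem succ {f : ℕ → ℝ} (hf : PolyBdd f) : PolyBdd fun k => f (k + 1) := by
  obtain ⟨C, p, hf⟩ := hf
  have hC := nonneg_const hf
  refine ⟨C * 2 ^ p, p, fun k => (hf (k + 1)).trans ?_⟩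
  rw [mul_assoc, ← mul_pow]
  push_cast
  gcongr
  linarith [Nat.cast_nonneg (α := ℝ) k]

theorem sum_range {f : ℕ → ℝ} (hf : PolyBdd f) : PolyBdd fun k => ∑ j ∈ Finset.range k, f j := by
  obtain ⟨C, p, hf⟩ := hf
  have hC := nonneg_const hf
  refine ⟨C, p + 1, fun k => ?_⟩
  calc |∑ j ∈ Finset.range k, f j| ≤ ∑ j ∈ Finset.range k, |f j| :=
        Finset.abs_sum_le_sum_abs _ _
    _ ≤ ∑ j ∈ Finset.range k, C * ((k : ℝ) + 1) ^ p := by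
      refine Finset.sum_le_sum fun j hj => (hf j).trans ?_
      have : (j : ℝ) ≤ k := by exact_mod_cast (Finset.mem_range.1 hj).le
      gcongr
    _ = k * (C * ((k : ℝ) + 1) ^ p) := by simp
    _ ≤ ((k : ℝ) + 1) * (C * ((k : ℝ) + 1) ^ p) := by
      gcongr
      linarith
    _ = _ := by ring

open Asymptotics in
theorem of_isLittleO {f : ℕ → ℝ} {c a : ℝ} (ha : 0 < a)
    (h : (fun k => f k - c * (k : ℝ) ^ a) =o[atTop] fun k : ℕ => (k : ℝ) ^ a) : PolyBdd f := by
  have hp : PolyBdd fun k : ℕ => (k : ℝ) ^ a := by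
    refine ⟨1, ⌈a⌉₊, fun k => ?_⟩
    rw [abs_of_nonneg (by positivity), one_mul, ← Real.rpow_natCast]
    calc (k : ℝ) ^ a ≤ ((k : ℝ) + 1) ^ a := by gcongr; linarith
      _ ≤ _ := Real.rpow_le_rpow_of_exponent_le (by linarith [Nat.cast_nonneg (α := ℝ) k])
        (Nat.le_ceil a)
  obtain ⟨N, hN⟩ := (eventually_forall_abs_le_of_isLittleO ha h one_pos).exists
  obtain ⟨C, p, hC⟩ := ((hp.const_mul (1 + |c|)).add (const ((N : ℝ) ^ a)))
  refine ⟨C, p, fun k => le_trans ?_ ((le_abs_self _).trans (hC k))⟩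
  calc |f k| = |(f k - c * (k : ℝ) ^ a) + c * (k : ℝ) ^ a| := by congr 1; ring
    _ ≤ 1 * ((k : ℝ) ^ a + (N : ℝ) ^ a) + |c| * (k : ℝ) ^ a := by
      refine (abs_add_le _ _).trans (add_le_add (hN k) ?_)
      rw [abs_mul, abs_of_nonneg (by positivity : 0 ≤ (k : ℝ) ^ a)]
    _ = _ := by ring

end PolyBdd

/-- The weights `ν n k` satisfy the forward equations of the law of the number of red draws
preceding the `n`-th blue draw, for inverse blue weights `β` and red weights `r`. -/
structure IsUrnLaw (β r : ℕ → ℝ) (ν : ℕ → ℕ → ℝ) : Prop where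
  β_pos : ∀ n, 0 < β n
  r_pos : ∀ k, 0 < r k
  tendsto_r : Tendsto r atTop (nhds 0)
  polyBdd_r : PolyBdd r
  nonneg : ∀ n k, 0 ≤ ν n k
  init : ∀ k, ν 0 k = if k = 0 then 1 else 0
  zero : ∀ n, ν (n + 1) 0 * (1 + β n * r 0) = ν n 0
  succ : ∀ n k, ν (n + 1) (k + 1) * (1 + β n * r (k + 1))
    = ν n (k + 1) + ν (n + 1) k * (β n * r k)

theorem exists_le_geometric {a ρ : ℕ → ℝ} {C : ℝ} (ha : ∀ k, 0 ≤ a k) (hC : 0 ≤ C)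
    (hρ : ∀ᶠ k in atTop, ρ k ≤ 1 / 4)
    (h : ∀ k, a (k + 1) ≤ C * (1 / 2) ^ (k + 1) + a k * ρ k) :
    ∃ C' ≥ 0, ∀ k, a k ≤ C' * (1 / 2) ^ k := by
  obtain ⟨K, hK⟩ := eventually_atTop.1 hρ
  obtain ⟨S, hS⟩ : ∃ S, S = ∑ i ∈ Finset.range (K + 1), a i * 2 ^ i := ⟨_, rfl⟩
  have hS0 : 0 ≤ S := hS ▸ Finset.sum_nonneg fun i _ => mul_nonneg (ha i) (by positivity)
  refine ⟨2 * C + S, by positivity, fun k => ?_⟩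
  have small : ∀ k ≤ K, a k ≤ (2 * C + S) * (1 / 2) ^ k := fun k hk => by
    have h1 : a k * 2 ^ k ≤ S := hS ▸ Finset.single_le_sum (f := fun i => a i * 2 ^ i)
      (fun i _ => mul_nonneg (ha i) (by positivity)) (Finset.mem_range.2 (by omega))
    calc a k = a k * 2 ^ k * (1 / 2) ^ k := by
          rw [mul_assoc, ← mul_pow]; norm_num
      _ ≤ _ := by gcongr; linarith
  rcases le_total k K with hk | hk
  · exact small k hk
  · induction k, hk using Nat.le_induction with
    | base => exact small K le_rfl
    | succ k hk ih =>
      calc a (k + 1) ≤ C * (1 / 2) ^ (k + 1) + a k * ρ k := h k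
        _ ≤ C * (1 / 2) ^ (k + 1) + ((2 * C + S) * (1 / 2) ^ k) * (1 / 4) := by
          have := mul_le_mul_of_nonneg_left (hK k hk) (ha k)
          linarith
        _ = (2 * C + S / 2) * (1 / 2) ^ (k + 1) := by ring
        _ ≤ _ := by gcongr; linarith

namespace IsUrnLaw

variable {β r : ℕ → ℝ} {ν : ℕ → ℕ → ℝ}

theorem exists_le_geometric (hν : IsUrnLaw β r ν) (n : ℕ) : ∃ C ≥ 0, ∀ k, ν n k ≤ C * (1 / 2) ^ k := by
  induction n with
  | zero =>
    refine ⟨1, zero_le_one, fun k => ?_⟩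
    rw [hν.init]
    split_ifs with hk
    · simp [hk]
    · positivity
  | succ n ih =>
    obtain ⟨C, hC, h⟩ := ih
    refine _root_.exists_le_geometric (ρ := fun k => β n * r k) (hν.nonneg _) hC ?_ fun k => ?_
    · have := hν.tendsto_r.const_mul (β n)
      rw [mul_zero] at this
      exact this.eventually_le_const (by norm_num)
    · have h1 := hν.succ n k
      have h2 := mul_nonneg (hν.nonneg (n + 1) (k + 1)) (mul_pos (hν.β_pos n) (hν.r_pos (k + 1))).le
      have h3 := h (k + 1)
      linarith

theorem summable (hν : IsUrnLaw β r ν) (n : ℕ) {f : ℕ → ℝ} (hf : PolyBdd f) :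
    Summable fun k => ν n k * f k := by
  obtain ⟨C, hC, h⟩ := hν.exists_le_geometric n
  obtain ⟨D, p, hD⟩ := hf
  have h1 : Summable fun k : ℕ => (k : ℝ) ^ p * (1 / 2 : ℝ) ^ k :=
    summable_pow_mul_geometric_of_norm_lt_one p (by norm_num)
  have h2 := ((summable_nat_add_iff 1).2 h1).mul_left (2 * (C * D))
  refine Summable.of_norm_bounded h2 fun k => ?_
  rw [norm_mul, Real.norm_eq_abs, Real.norm_eq_abs, abs_of_nonneg (hν.nonneg n k)]
  calc ν n k * |f k| ≤ (C * (1 / 2) ^ k) * (D * ((k : ℝ) + 1) ^ p) := by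
        gcongr
        · exact h k
        · exact hD k
    _ = _ := by push_cast; ring

theorem tsum_step (hν : IsUrnLaw β r ν) (n : ℕ) {f : ℕ → ℝ} (hf : PolyBdd f) :
    ∑' k, ν n k * f k
      = ∑' k, ν (n + 1) k * (f k - β n * r k * (f (k + 1) - f k)) := by
  have s0 := hν.summable n hf
  have hrf := (hν.polyBdd_r.const_mul (β n)).mul hf
  have hrf' := (hν.polyBdd_r.const_mul (β n)).mul hf.succ
  have s1 := hν.summable (n + 1) (hf.add hrf)
  have s2 := hν.summable (n + 1) hrf'
  have key : ∑' k, ν n k * f k + ∑' k, ν (n + 1) k * (β n * r k * f (k + 1))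
      = ∑' k, ν (n + 1) k * (f k + β n * r k * f k) := by
    rw [s0.tsum_eq_zero_add, s1.tsum_eq_zero_add, add_assoc,
      ← Summable.tsum_add ((summable_nat_add_iff 1).2 s0) s2]
    congr 1
    · rw [← hν.zero n]; ring
    · refine tsum_congr fun k => ?_
      linear_combination (-f (k + 1)) * hν.succ n k
  rw [← eq_sub_iff_add_eq] at key
  rw [key, ← Summable.tsum_sub s1 s2]
  refine tsum_congr fun k => ?_
  ring

/-- The mean of `f` with respect to the weights `ν n`. -/
noncomputable def mean (_ : IsUrnLaw β r ν) (n : ℕ) (f : ℕ → ℝ) : ℝ := ∑' k, ν n k * f k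

theorem mean_step (hν : IsUrnLaw β r ν) (n : ℕ) {f : ℕ → ℝ} (hf : PolyBdd f) :
    hν.mean n f = hν.mean (n + 1) fun k => f k - β n * r k * (f (k + 1) - f k) :=
  hν.tsum_step n hf

theorem mean_init (hν : IsUrnLaw β r ν) (f : ℕ → ℝ) : hν.mean 0 f = f 0 := by
  rw [mean, tsum_eq_single 0]
  · simp [hν.init]
  · intro k hk
    simp [hν.init, hk]

theorem mean_const (hν : IsUrnLaw β r ν) (n : ℕ) (c : ℝ) : hν.mean n (fun _ => c) = c := by
  induction n with
  | zero => exact hν.mean_init fun _ => c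
  | succ n ih =>
    have h := hν.mean_step n (PolyBdd.const c)
    simp only [sub_self, mul_zero, sub_zero] at h
    rw [← h, ih]

theorem mean_mono (hν : IsUrnLaw β r ν) (n : ℕ) {f g : ℕ → ℝ} (hf : PolyBdd f) (hg : PolyBdd g)
    (h : ∀ k, f k ≤ g k) : hν.mean n f ≤ hν.mean n g :=
  Summable.tsum_le_tsum (fun k => mul_le_mul_of_nonneg_left (h k) (hν.nonneg n k))
    (hν.summable n hf) (hν.summable n hg)

theorem mean_add (hν : IsUrnLaw β r ν) (n : ℕ) {f g : ℕ → ℝ} (hf : PolyBdd f) (hg : PolyBdd g) :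
    hν.mean n (fun k => f k + g k) = hν.mean n f + hν.mean n g := by
  simp only [mean, mul_add]
  exact Summable.tsum_add (hν.summable n hf) (hν.summable n hg)

theorem mean_sub (hν : IsUrnLaw β r ν) (n : ℕ) {f g : ℕ → ℝ} (hf : PolyBdd f) (hg : PolyBdd g) :
    hν.mean n (fun k => f k - g k) = hν.mean n f - hν.mean n g := by
  simp only [mean, mul_sub]
  exact Summable.tsum_sub (hν.summable n hf) (hν.summable n hg)

theorem mean_const_mul (hν : IsUrnLaw β r ν) (n : ℕ) (c : ℝ) (f : ℕ → ℝ) :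
    hν.mean n (fun k => c * f k) = c * hν.mean n f := by
  simp only [mean, mul_left_comm _ c]
  exact tsum_mul_left

theorem mean_nonneg (hν : IsUrnLaw β r ν) (n : ℕ) {f : ℕ → ℝ} (h : ∀ k, 0 ≤ f k) :
    0 ≤ hν.mean n f :=
  tsum_nonneg fun k => mul_nonneg (hν.nonneg n k) (h k)

theorem abs_mean_le (hν : IsUrnLaw β r ν) (n : ℕ) {f g : ℕ → ℝ} (hf : PolyBdd f) (hg : PolyBdd g)
    (h : ∀ k, |f k| ≤ g k) : |hν.mean n f| ≤ hν.mean n g := by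
  refine abs_le.2 ⟨?_, hν.mean_mono n hf hg fun k => (le_abs_self _).trans (h k)⟩
  have h1 := hν.mean_mono n (hg.const_mul (-1)) hf fun k => by
    have := neg_abs_le (f k)
    have := h k
    linarith
  rw [mean_const_mul] at h1
  linarith

end IsUrnLaw

theorem quartic_sub_le {M β q T : ℝ} (hβ : 0 ≤ β) (hβT : β ≤ T) (hq : 0 ≤ q) (hqT : q ≤ T) :
    M ^ 4 - 24 * (M ^ 2 * T ^ 2) - 26 * T ^ 4
      ≤ (M + β) ^ 4
        - β * (4 * (M + β) ^ 3 + 6 * (M + β) ^ 2 * q + 4 * (M + β) * q ^ 2 + q ^ 3) := by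
  have hT : 0 ≤ T := hβ.trans hβT
  have b2 : β * β ≤ T * T := mul_le_mul hβT hβT hβ hT
  have bq : β * q ≤ T * T := mul_le_mul hβT hqT hq hT
  have b2' : 0 ≤ β * β := mul_nonneg hβ hβ
  have bq' : 0 ≤ β * q := mul_nonneg hβ hq
  have hM : ∀ {x : ℝ}, x ≤ T * T * T → 0 ≤ x → M * x ≤ (M ^ 2 * T ^ 2 + T ^ 4) / 2 := by
    intro x hx hx0
    have h1 : M * x ≤ |M| * (T * T * T) :=
      (mul_le_mul_of_nonneg_right (le_abs_self M) hx0).trans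
        (mul_le_mul_of_nonneg_left hx (abs_nonneg M))
    have h2 := sq_nonneg (|M| * T - T * T)
    have h3 := sq_abs M
    have h4 : (|M| * T - T * T) ^ 2 = M ^ 2 * T ^ 2 - 2 * (|M| * (T * T * T)) + T ^ 4 := by
      rw [← h3]; ring
    linarith
  have c1 := mul_le_mul_of_nonneg_left b2 (sq_nonneg M)
  have c2 := mul_le_mul_of_nonneg_left bq (sq_nonneg M)
  have m1 := hM (mul_le_mul b2 hβT hβ (by positivity)) (mul_nonneg b2' hβ)
  have m2 := hM (mul_le_mul b2 hqT hq (by positivity)) (mul_nonneg b2' hq)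
  have m3 := hM (mul_le_mul bq hqT hq (by positivity)) (mul_nonneg bq' hq)
  have d1 := mul_le_mul b2 b2 b2' (by positivity)
  have d2 := mul_le_mul b2 bq bq' (by positivity)
  have d3 := mul_le_mul bq bq bq' (by positivity)
  have d4 := mul_le_mul bq (mul_le_mul hqT hqT hq hT) (mul_nonneg hq hq) (by positivity)
  have e : (M + β) ^ 4
        - β * (4 * (M + β) ^ 3 + 6 * (M + β) ^ 2 * q + 4 * (M + β) * q ^ 2 + q ^ 3)
      = M ^ 4 - 6 * (M ^ 2 * (β * β)) - 8 * (M * (β * β * β)) - 3 * (β * β * (β * β))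
        - 6 * (M ^ 2 * (β * q)) - 12 * (M * (β * β * q)) - 6 * (β * β * (β * q))
        - 4 * (M * (β * q * q)) - 4 * (β * q * (β * q)) - β * q * (q * q) := by ring
  rw [e]
  linarith

theorem exists_eventually_le_rpow_of_step {u : ℕ → ℝ} {s C : ℝ} (hs : 0 ≤ s) (hC : 0 < C)
    (h : ∀ᶠ n : ℕ in atTop,
      (1 - C / ((n + 1 : ℕ) : ℝ) ^ 2) * u (n + 1) ≤ u n + C * ((n + 1 : ℕ) : ℝ) ^ s) :
    ∃ K > 0, ∀ᶠ n : ℕ in atTop, u n ≤ K * (n : ℝ) ^ (s + 1) := by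
  obtain ⟨n₀, hn₀⟩ := eventually_atTop.1 (h.and
    (tendsto_natCast_atTop_atTop.eventually_ge_atTop (2 * C + 1)))
  refine ⟨2 * C + |u n₀|, by positivity, eventually_atTop.2 ⟨n₀, fun n hn => ?_⟩⟩
  obtain ⟨K, hK⟩ : ∃ K, K = 2 * C + |u n₀| := ⟨_, rfl⟩
  rw [← hK]
  have hK0 : 0 < K := by rw [hK]; positivity
  have hKC : 2 * C ≤ K := by rw [hK]; linarith [abs_nonneg (u n₀)]
  induction n, hn using Nat.le_induction with
  | base =>
    have h1 : (1 : ℝ) ≤ (n₀ : ℝ) ^ (s + 1) :=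
      Real.one_le_rpow (by linarith [(hn₀ n₀ le_rfl).2]) (by linarith)
    calc u n₀ ≤ K := by rw [hK]; linarith [le_abs_self (u n₀)]
      _ ≤ _ := le_mul_of_one_le_right hK0.le h1
  | succ n hn ih =>
    obtain ⟨h1, h2⟩ := hn₀ n hn
    push_cast at h1 ⊢
    obtain ⟨N, hN⟩ : ∃ N : ℝ, N = (n : ℝ) + 1 := ⟨_, rfl⟩
    have hN0 : 0 < N := by linarith
    rw [← hN] at h1 ⊢
    obtain ⟨P, hP⟩ : ∃ P : ℝ, P = N ^ s := ⟨_, rfl⟩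
    have hP0 : 0 < P := by rw [hP]; positivity
    have e1 : N ^ (s + 1) = N * P := by rw [hP, Real.rpow_add_one hN0.ne', mul_comm]
    have e2 : (n : ℝ) ^ (s + 1) ≤ (N - 1) * P := by
      rw [Real.rpow_add_one (by linarith : (n : ℝ) ≠ 0), mul_comm, hN, hP, add_sub_cancel_right]
      gcongr
      linarith
    rw [← hP] at h1
    rw [e1]
    by_contra! hlt
    have f1 : 0 < 1 - C / N ^ 2 := by
      have : C / N ^ 2 < 1 := by
        rw [div_lt_one (by positivity)]
        nlinarith
      linarith
    have g1 := mul_lt_mul_of_pos_left hlt f1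
    have g2 := mul_le_mul_of_nonneg_left e2 hK0.le
    have g3 : C / N ^ 2 * (K * (N * P)) ≤ K * P / 2 := by
      have : C / N ^ 2 * (K * (N * P)) = K * P * (C / N) := by field_simp
      rw [this]
      have : C / N ≤ 1 / 2 := by rw [div_le_iff₀ hN0]; linarith
      calc K * P * (C / N) ≤ K * P * (1 / 2) := by gcongr
        _ = _ := by ring
    have g4 : C * P ≤ K * P / 2 := by
      have := mul_le_mul_of_nonneg_right hKC hP0.le
      linarith
    linarith

/-- `Φ` and `A` are antiderivatives of `q = 1 / r` and of `β` starting from the same value. -/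
structure IsUrnScale (β r q Φ A : ℕ → ℝ) : Prop where
  mul_eq_one : ∀ k, q k * r k = 1
  polyBdd : PolyBdd q
  polyBdd_sum : PolyBdd Φ
  succ_left : ∀ k, Φ (k + 1) = Φ k + q k
  succ_right : ∀ n, A (n + 1) = A n + β n
  init : Φ 0 = A 0

namespace IsUrnLaw

variable {β r q Φ A : ℕ → ℝ} {ν : ℕ → ℕ → ℝ}

theorem q_pos (hν : IsUrnLaw β r ν) (hs : IsUrnScale β r q Φ A) (k : ℕ) : 0 < q k :=
  pos_of_mul_pos_left (by rw [hs.mul_eq_one]; exact one_pos) (hν.r_pos k).le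

theorem polyBdd_sub_pow (hs : IsUrnScale β r q Φ A) (n p : ℕ) :
    PolyBdd fun k => (Φ k - A n) ^ p :=
  (hs.polyBdd_sum.sub (PolyBdd.const (A n))).pow p

theorem mean_sub_eq_zero (hν : IsUrnLaw β r ν) (hs : IsUrnScale β r q Φ A) (n : ℕ) :
    hν.mean n (fun k => Φ k - A n) = 0 := by
  induction n with
  | zero => rw [hν.mean_init, hs.init, sub_self]
  | succ n ih =>
    rw [← ih, hν.mean_step n (hs.polyBdd_sum.sub (PolyBdd.const (A n)))]
    congr 1
    funext k
    rw [hs.succ_left, hs.succ_right]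
    linear_combination β n * hs.mul_eq_one k

theorem mean_sq_step (hν : IsUrnLaw β r ν) (hs : IsUrnScale β r q Φ A) (n : ℕ) :
    hν.mean n (fun k => (Φ k - A n) ^ 2)
      = hν.mean (n + 1) (fun k => (Φ k - A (n + 1)) ^ 2)
        - hν.mean (n + 1) (fun k => β n ^ 2 + β n * q k) := by
  rw [hν.mean_step n (polyBdd_sub_pow hs n 2), ← hν.mean_sub _ (polyBdd_sub_pow hs _ 2)
    ((PolyBdd.const _).add (hs.polyBdd.const_mul _))]
  congr 1
  funext k
  rw [hs.succ_left, hs.succ_right]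
  linear_combination (-β n * (q k + 2 * (Φ k - A n))) * hs.mul_eq_one k

theorem le_mean_four_step (hν : IsUrnLaw β r ν) (hs : IsUrnScale β r q Φ A) (n : ℕ) {T : ℕ → ℝ}
    (hT : PolyBdd T) (hβT : ∀ k, β n ≤ T k) (hqT : ∀ k, q k ≤ T k) :
    hν.mean (n + 1) (fun k => (Φ k - A (n + 1)) ^ 4
        - (24 * ((Φ k - A (n + 1)) ^ 2 * T k ^ 2) + 26 * T k ^ 4))
      ≤ hν.mean n (fun k => (Φ k - A n) ^ 4) := by
  rw [hν.mean_step n (polyBdd_sub_pow hs n 4)]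
  refine hν.mean_mono _ ((polyBdd_sub_pow hs _ 4).sub
    ((((polyBdd_sub_pow hs _ 2).mul (hT.pow 2)).const_mul _).add ((hT.pow 4).const_mul _)))
    ((polyBdd_sub_pow hs n 4).sub ((hν.polyBdd_r.const_mul _).mul
      ((polyBdd_sub_pow hs n 4).succ.sub (polyBdd_sub_pow hs n 4)))) fun k => ?_
  have h1 := quartic_sub_le (M := Φ k - A (n + 1)) (hν.β_pos n).le (hβT k)
    (hν.q_pos hs k).le (hqT k)
  rw [← sub_sub]
  refine h1.trans (le_of_eq ?_)
  rw [hs.succ_left, hs.succ_right]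
  linear_combination (β n * (4 * (Φ k - A n) ^ 3 + 6 * (Φ k - A n) ^ 2 * q k
    + 4 * (Φ k - A n) * q k ^ 2 + q k ^ 3)) * hs.mul_eq_one k

end IsUrnLaw

theorem PolyBdd.abs {f : ℕ → ℝ} (hf : PolyBdd f) : PolyBdd fun k => |f k| := by
  obtain ⟨C, p, h⟩ := hf
  exact ⟨C, p, fun k => by rw [abs_abs]; exact h k⟩

theorem sq_one_add_abs_le (C P N m : ℝ) (hN : 0 < N) (hP : 0 < P) :
    (C * P * (1 + |m|)) ^ 2 ≤ 2 * C ^ 2 * (P ^ 2 + (N * P * m) ^ 2 / N ^ 2) := by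
  have e : (N * P * m) ^ 2 / N ^ 2 = P ^ 2 * |m| ^ 2 := by rw [sq_abs]; field_simp
  rw [e]
  nlinarith [mul_nonneg (sq_nonneg (C * P)) (sq_nonneg (1 - |m|))]

theorem pow_four_one_add_abs_le (C P N m : ℝ) (hN : 1 ≤ N) (hP : 0 < P) :
    (C * P * (1 + |m|)) ^ 4 ≤ 8 * C ^ 4 * (P ^ 4 + (N * P * m) ^ 4 / N ^ 2) := by
  have hN0 : 0 < N := by linarith
  have h1 := pow_le_pow_left₀ (by positivity) (sq_one_add_abs_le C P N m hN0 hP) 2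
  obtain ⟨y, hy⟩ : ∃ y, y = (N * P * m) ^ 2 / N ^ 2 := ⟨_, rfl⟩
  have h2 : y ^ 2 ≤ (N * P * m) ^ 4 / N ^ 2 := by
    have : y ^ 2 = (N * P * m) ^ 4 / N ^ 2 / N ^ 2 := by rw [hy]; field_simp
    rw [this]
    exact div_le_self (by positivity) (one_le_pow₀ hN)
  rw [← hy] at h1
  have h3 : (P ^ 2 + y) ^ 2 ≤ 2 * (P ^ 4 + y ^ 2) := by nlinarith [sq_nonneg (P ^ 2 - y)]
  calc (C * P * (1 + |m|)) ^ 4 = ((C * P * (1 + |m|)) ^ 2) ^ 2 := by ring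
    _ ≤ (2 * C ^ 2 * (P ^ 2 + y)) ^ 2 := h1
    _ = 4 * C ^ 4 * (P ^ 2 + y) ^ 2 := by ring
    _ ≤ 4 * C ^ 4 * (2 * (P ^ 4 + y ^ 2)) := by gcongr
    _ ≤ 4 * C ^ 4 * (2 * (P ^ 4 + (N * P * m) ^ 4 / N ^ 2)) := by gcongr
    _ = _ := by ring

theorem sub_eq_mul_scaledDiff {α : ℝ} {N : ℕ} (hN : 0 < N) (Φ A : ℕ → ℝ) (k : ℕ) :
    Φ k - A N = N * (N : ℝ) ^ α * scaledDiff α Φ A N k := by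
  have hN' : (0 : ℝ) < N := by exact_mod_cast hN
  rw [scaledDiff, Real.rpow_add_one hN'.ne', mul_comm ((N : ℝ) ^ α),
    mul_div_cancel₀ _ (by positivity)]

theorem PolyBdd.scaledDiff {Φ : ℕ → ℝ} (hΦ : PolyBdd Φ) (α : ℝ) (A : ℕ → ℝ) (N : ℕ) :
    PolyBdd fun k => scaledDiff α Φ A N k := by
  have := (hΦ.sub (PolyBdd.const (A N))).const_mul (((N : ℝ) ^ (α + 1))⁻¹)
  simpa only [_root_.scaledDiff, div_eq_inv_mul] using this

namespace IsUrnLaw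

variable {β r q Φ A : ℕ → ℝ} {ν : ℕ → ℕ → ℝ}

theorem exists_mean_sq_le (hν : IsUrnLaw β r ν) (hs : IsUrnScale β r q Φ A) {α C : ℝ}
    (hα : 0 < α) (hC : 0 < C) (hT : ∀ᶠ n : ℕ in atTop, β n ≤ C * ((n + 1 : ℕ) : ℝ) ^ α ∧
      ∀ k, q k ≤ C * ((n + 1 : ℕ) : ℝ) ^ α * (1 + |scaledDiff α Φ A (n + 1) k|)) :
    ∃ K > 0, ∀ᶠ n : ℕ in atTop,
      hν.mean n (fun k => (Φ k - A n) ^ 2) ≤ K * (n : ℝ) ^ (2 * α + 1) := by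
  refine exists_eventually_le_rpow_of_step (C := 4 * C ^ 2) (by positivity) (by positivity) ?_
  filter_upwards [hT] with n ⟨h1, h2⟩
  rw [hν.mean_sq_step hs n]
  have hN : (1 : ℝ) ≤ (n + 1 : ℕ) := by push_cast; linarith [Nat.cast_nonneg (α := ℝ) n]
  have hd := sub_eq_mul_scaledDiff (α := α) n.succ_pos Φ A
  obtain ⟨m, hm⟩ : ∃ m, m = scaledDiff α Φ A (n + 1) := ⟨_, rfl⟩
  obtain ⟨N, hN'⟩ : ∃ N : ℝ, N = (n + 1 : ℕ) := ⟨_, rfl⟩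
  rw [Nat.succ_eq_add_one, ← hN', ← hm] at hd
  rw [← hN'] at hN h1 ⊢
  rw [← hN', ← hm] at h2
  have hP : 0 < N ^ α := by positivity
  have e2 : N ^ (2 * α) = (N ^ α) ^ 2 := by
    rw [mul_comm, Real.rpow_mul (by linarith)]; norm_cast
  rw [e2]
  have p2 := polyBdd_sub_pow hs (n + 1) 2
  have key : hν.mean (n + 1) (fun k => β n ^ 2 + β n * q k)
      ≤ hν.mean (n + 1) (fun k => 4 * C ^ 2 * (N ^ α) ^ 2
        + 4 * C ^ 2 / N ^ 2 * (Φ k - A (n + 1)) ^ 2) := by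
    refine hν.mean_mono _ ((PolyBdd.const _).add (hs.polyBdd.const_mul _))
      ((PolyBdd.const _).add (p2.const_mul _)) fun k => ?_
    have f1 := sq_one_add_abs_le C (N ^ α) N (m k) (by linarith) hP
    rw [← hd k] at f1
    have f2 : β n ≤ C * N ^ α * (1 + |m k|) :=
      h1.trans (le_mul_of_one_le_right (by positivity) (by linarith [abs_nonneg (m k)]))
    have f3 := mul_le_mul f2 f2 (hν.β_pos n).le ((hν.β_pos n).le.trans f2)
    have f4 := mul_le_mul f2 (h2 k) (hν.q_pos hs k).le ((hν.β_pos n).le.trans f2)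
    calc β n ^ 2 + β n * q k ≤ 2 * (C * N ^ α * (1 + |m k|)) ^ 2 := by linarith
      _ ≤ 2 * (2 * C ^ 2 * ((N ^ α) ^ 2 + (Φ k - A (n + 1)) ^ 2 / N ^ 2)) := by linarith
      _ = _ := by ring
  rw [hν.mean_add _ (PolyBdd.const _) (p2.const_mul _), hν.mean_const, hν.mean_const_mul] at key
  linarith

theorem exists_mean_four_le (hν : IsUrnLaw β r ν) (hs : IsUrnScale β r q Φ A) {α C : ℝ}
    (hα : 0 < α) (hC : 0 < C) (hT : ∀ᶠ n : ℕ in atTop, β n ≤ C * ((n + 1 : ℕ) : ℝ) ^ α ∧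
      ∀ k, q k ≤ C * ((n + 1 : ℕ) : ℝ) ^ α * (1 + |scaledDiff α Φ A (n + 1) k|)) :
    ∃ K > 0, ∀ᶠ n : ℕ in atTop,
      hν.mean n (fun k => (Φ k - A n) ^ 4) ≤ K * (n : ℝ) ^ (4 * α + 2) := by
  obtain ⟨K, hK, hK2⟩ := hν.exists_mean_sq_le hs hα hC hT
  have hs' : 4 * α + 2 = (4 * α + 1) + 1 := by ring
  rw [hs']
  refine exists_eventually_le_rpow_of_step (C := 48 * C ^ 2 * (1 + K) + 208 * C ^ 4)
    (by positivity) (by positivity) ?_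
  filter_upwards [hT, (tendsto_add_atTop_nat 1).eventually hK2] with n ⟨h1, h2⟩ h3
  have hN : (1 : ℝ) ≤ (n + 1 : ℕ) := by push_cast; linarith [Nat.cast_nonneg (α := ℝ) n]
  have hd := sub_eq_mul_scaledDiff (α := α) n.succ_pos Φ A
  have pm := hs.polyBdd_sum.scaledDiff α A (n + 1)
  obtain ⟨m, hm⟩ : ∃ m, m = scaledDiff α Φ A (n + 1) := ⟨_, rfl⟩
  obtain ⟨N, hN'⟩ : ∃ N : ℝ, N = (n + 1 : ℕ) := ⟨_, rfl⟩
  rw [Nat.succ_eq_add_one, ← hN', ← hm] at hd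
  rw [← hN'] at hN h1 h3 ⊢
  rw [← hN', ← hm] at h2
  rw [← hm] at pm
  have hN0 : 0 < N := by linarith
  obtain ⟨P, hP'⟩ : ∃ P : ℝ, P = N ^ α := ⟨_, rfl⟩
  have hP : 0 < P := by rw [hP']; positivity
  have e2 : N ^ (2 * α + 1) = N * P ^ 2 := by
    rw [Real.rpow_add_one hN0.ne', mul_comm 2 α, Real.rpow_mul (by linarith), hP', mul_comm]
    norm_cast
  have e4 : N ^ (4 * α + 1) = N * P ^ 4 := by
    rw [Real.rpow_add_one hN0.ne', mul_comm 4 α, Real.rpow_mul (by linarith), hP', mul_comm]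
    norm_cast
  rw [e4]
  rw [e2] at h3
  rw [← hP'] at h1 h2 hd
  have p2 := polyBdd_sub_pow hs (n + 1) 2
  have p4 := polyBdd_sub_pow hs (n + 1) 4
  have pT : PolyBdd fun k => C * P * (1 + |m k|) :=
    ((PolyBdd.const 1).add pm.abs).const_mul (C * P)
  have key := hν.le_mean_four_step hs n pT (fun k => h1.trans (le_mul_of_one_le_right
    (by positivity) (by linarith [abs_nonneg (m k)]))) h2
  have pE : PolyBdd fun k => 24 * ((Φ k - A (n + 1)) ^ 2 * (C * P * (1 + |m k|)) ^ 2)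
      + 26 * (C * P * (1 + |m k|)) ^ 4 :=
    ((p2.mul (pT.pow 2)).const_mul _).add ((pT.pow 4).const_mul _)
  rw [hν.mean_sub _ p4 pE] at key
  have err : hν.mean (n + 1) (fun k => 24 * ((Φ k - A (n + 1)) ^ 2 * (C * P * (1 + |m k|)) ^ 2)
      + 26 * (C * P * (1 + |m k|)) ^ 4)
      ≤ hν.mean (n + 1) (fun k => 48 * C ^ 2 * P ^ 2 * (Φ k - A (n + 1)) ^ 2
        + (48 * C ^ 2 + 208 * C ^ 4) / N ^ 2 * (Φ k - A (n + 1)) ^ 4 + 208 * C ^ 4 * P ^ 4) := by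
    refine hν.mean_mono _ pE (((p2.const_mul _).add (p4.const_mul _)).add (PolyBdd.const _))
      fun k => ?_
    have f1 := sq_one_add_abs_le C P N (m k) hN0 hP
    have f2 := pow_four_one_add_abs_le C P N (m k) hN hP
    rw [← hd k] at f1 f2
    have f3 := mul_le_mul_of_nonneg_left f1 (sq_nonneg (Φ k - A (n + 1)))
    calc _ ≤ 24 * ((Φ k - A (n + 1)) ^ 2 *
          (2 * C ^ 2 * (P ^ 2 + (Φ k - A (n + 1)) ^ 2 / N ^ 2)))
          + 26 * (8 * C ^ 4 * (P ^ 4 + (Φ k - A (n + 1)) ^ 4 / N ^ 2)) := by linarith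
      _ = _ := by ring
  rw [hν.mean_add _ ((p2.const_mul _).add (p4.const_mul _)) (PolyBdd.const _),
    hν.mean_add _ (p2.const_mul _) (p4.const_mul _), hν.mean_const, hν.mean_const_mul,
    hν.mean_const_mul] at err
  have g1 : 48 * C ^ 2 * P ^ 2 * hν.mean (n + 1) (fun k => (Φ k - A (n + 1)) ^ 2)
      ≤ 48 * C ^ 2 * P ^ 2 * (K * (N * P ^ 2)) := by gcongr
  have g2 : 208 * C ^ 4 * P ^ 4 ≤ 208 * C ^ 4 * P ^ 4 * N :=
    le_mul_of_one_le_right (by positivity) hN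
  have g3 : 0 ≤ 48 * C ^ 2 * (N * P ^ 4) := by positivity
  have g4 : 0 ≤ 48 * C ^ 2 * K / N ^ 2 * hν.mean (n + 1) (fun k => (Φ k - A (n + 1)) ^ 4) :=
    mul_nonneg (by positivity) (hν.mean_nonneg _ fun k => by positivity)
  obtain ⟨X, hX⟩ : ∃ X, X = hν.mean (n + 1) (fun k => (Φ k - A (n + 1)) ^ 4) := ⟨_, rfl⟩
  rw [← hX] at key err g4 ⊢
  have e5 : (1 - (48 * C ^ 2 * (1 + K) + 208 * C ^ 4) / N ^ 2) * X
      = X - (48 * C ^ 2 + 208 * C ^ 4) / N ^ 2 * X - 48 * C ^ 2 * K / N ^ 2 * X := by ring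
  rw [e5]
  linarith

end IsUrnLaw

open Asymptotics in
theorem mul_sub_isLittleO {u v x : ℕ → ℝ} {a b : ℝ}
    (hu : (fun n => u n - a * x n) =o[atTop] x) (hv : (fun n => v n - b * x n) =o[atTop] x) :
    (fun n => u n * v n - a * b * (x n * x n)) =o[atTop] fun n => x n * x n := by
  have hvO : v =O[atTop] x := by
    refine (hv.isBigO.add ((isBigO_refl x atTop).const_mul_left b)).congr_left fun n => ?_
    ring
  refine ((hu.mul_isBigO hvO).add
    (((isBigO_refl x atTop).const_mul_left a).mul_isLittleO hv)).congr_left fun n => ?_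
  ring

open Asymptotics in
theorem nat_succ_rpow_sub_isLittleO (a : ℝ) :
    (fun n : ℕ => ((n + 1 : ℕ) : ℝ) ^ a - (n : ℝ) ^ a) =o[atTop] fun n : ℕ => (n : ℝ) ^ a := by
  have h := nat_rpow_sub_one_isLittleO a
  refine (((nat_add_rpow_sub_isLittleO a 1).trans h).add
    (h.const_mul_left (a * 1))).congr_left fun n => ?_
  push_cast
  ring

namespace IsUrnLaw

variable {β r q Φ A : ℕ → ℝ} {ν : ℕ → ℕ → ℝ}

theorem mean_scaledDiff_pow (hν : IsUrnLaw β r ν) (α : ℝ) (N p : ℕ) :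
    hν.mean N (fun k => scaledDiff α Φ A N k ^ p)
      = (((N : ℝ) ^ (α + 1)) ^ p)⁻¹ * hν.mean N (fun k => (Φ k - A N) ^ p) := by
  rw [← hν.mean_const_mul]
  simp only [scaledDiff, div_eq_inv_mul, mul_pow, inv_pow]

theorem exists_mean_scaledDiff_sq_le (hν : IsUrnLaw β r ν) {α : ℝ}
    (h : ∃ K > 0, ∀ᶠ n : ℕ in atTop,
      hν.mean n (fun k => (Φ k - A n) ^ 2) ≤ K * (n : ℝ) ^ (2 * α + 1)) :
    ∃ K > 0, ∀ᶠ N : ℕ in atTop, hν.mean N (fun k => scaledDiff α Φ A N k ^ 2) ≤ K / N := by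
  obtain ⟨K, hK, h⟩ := h
  refine ⟨K, hK, ?_⟩
  filter_upwards [h, eventually_gt_atTop 0] with N hN hN0
  have hN' : (0 : ℝ) < N := by exact_mod_cast hN0
  rw [hν.mean_scaledDiff_pow, inv_mul_le_iff₀ (by positivity)]
  refine hN.trans (le_of_eq ?_)
  have e : ((N : ℝ) ^ (α + 1)) ^ 2 = (N : ℝ) ^ (2 * α + 1) * N := by
    rw [← Real.rpow_add_one hN'.ne', ← Real.rpow_mul_natCast hN'.le]
    congr 1
    push_cast
    ring
  rw [e]
  field_simp

theorem exists_mean_scaledDiff_four_le (hν : IsUrnLaw β r ν) {α : ℝ}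
    (h : ∃ K > 0, ∀ᶠ n : ℕ in atTop,
      hν.mean n (fun k => (Φ k - A n) ^ 4) ≤ K * (n : ℝ) ^ (4 * α + 2)) :
    ∃ K > 0, ∀ᶠ N : ℕ in atTop,
      hν.mean N (fun k => scaledDiff α Φ A N k ^ 4) ≤ K / (N : ℝ) ^ 2 := by
  obtain ⟨K, hK, h⟩ := h
  refine ⟨K, hK, ?_⟩
  filter_upwards [h, eventually_gt_atTop 0] with N hN hN0
  have hN' : (0 : ℝ) < N := by exact_mod_cast hN0
  rw [hν.mean_scaledDiff_pow, inv_mul_le_iff₀ (by positivity)]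
  refine hN.trans (le_of_eq ?_)
  have e : ((N : ℝ) ^ (α + 1)) ^ 4 = (N : ℝ) ^ (4 * α + 2) * (N : ℝ) ^ 2 := by
    rw [← Real.rpow_add_natCast hN'.ne', ← Real.rpow_mul_natCast hN'.le]
    congr 1
    push_cast
    ring
  rw [e]
  field_simp

open Asymptotics in
theorem mean_inv_weight_isLittleO (hν : IsUrnLaw β r ν) (hq : PolyBdd q) (hΦ : PolyBdd Φ)
    {α c : ℝ}
    (hqc : ∀ ε > 0, ∃ C > 0, ∀ᶠ N : ℕ in atTop, ∀ k : ℕ,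
      |q k - c * (N : ℝ) ^ α| ≤ (N : ℝ) ^ α * (ε + C * scaledDiff α Φ A N k ^ 2))
    (hm : ∃ K > 0, ∀ᶠ N : ℕ in atTop,
      hν.mean N (fun k => scaledDiff α Φ A N k ^ 2) ≤ K / N) :
    (fun N => hν.mean N q - c * (N : ℝ) ^ α) =o[atTop] fun N : ℕ => (N : ℝ) ^ α := by
  obtain ⟨K, hK, hm⟩ := hm
  refine isLittleO_iff.2 fun ε hε => ?_
  obtain ⟨C, hC, h⟩ := hqc (ε / 2) (by positivity)
  filter_upwards [h, hm, eventually_gt_atTop 0,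
    tendsto_natCast_atTop_atTop.eventually_ge_atTop (2 * C * K / ε)] with N h1 h2 hN0 hN
  have hN' : (0 : ℝ) < N := by exact_mod_cast hN0
  have pm := (hΦ.scaledDiff α A N).pow 2
  have pR := ((PolyBdd.const (ε / 2)).add (pm.const_mul C)).const_mul ((N : ℝ) ^ α)
  have h3 := hν.abs_mean_le N (hq.sub (PolyBdd.const (c * (N : ℝ) ^ α))) pR h1
  rw [hν.mean_sub _ hq (PolyBdd.const _), hν.mean_const, hν.mean_const_mul,
    hν.mean_add _ (PolyBdd.const _) (pm.const_mul C), hν.mean_const, hν.mean_const_mul] at h3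
  rw [Real.norm_eq_abs, Real.norm_of_nonneg (by positivity), mul_comm ε]
  refine h3.trans ?_
  have h4 : C * (K / N) ≤ ε / 2 := by
    rw [← mul_div_assoc, div_le_iff₀ hN']
    rw [div_le_iff₀ hε] at hN
    linarith
  have h5 := mul_le_mul_of_nonneg_left h2 hC.le
  gcongr
  linarith

open Asymptotics in
theorem mean_sq_isLittleO (hν : IsUrnLaw β r ν) (hs : IsUrnScale β r q Φ A) {α c : ℝ}
    (hα : 0 < α)
    (hβ : (fun n => β n - c * (n : ℝ) ^ α) =o[atTop] fun n : ℕ => (n : ℝ) ^ α)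
    (hq : (fun n => hν.mean n q - c * (n : ℝ) ^ α) =o[atTop] fun n : ℕ => (n : ℝ) ^ α) :
    (fun n => hν.mean n (fun k => (Φ k - A n) ^ 2)
        - 2 * c ^ 2 / (2 * α + 1) * (n : ℝ) ^ (2 * α + 1))
      =o[atTop] fun n : ℕ => (n : ℝ) ^ (2 * α + 1) := by
  refine isLittleO_rpow_of_sub_isLittleO (by positivity) ?_
  rw [add_sub_cancel_right]
  have hxx : ∀ n : ℕ, (n : ℝ) ^ α * (n : ℝ) ^ α = (n : ℝ) ^ (2 * α) := fun n => by
    rw [mul_comm 2 α, Real.rpow_mul (by positivity), ← sq]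
    norm_cast
  have hsucc := nat_succ_rpow_sub_isLittleO α
  have hq' : (fun n => hν.mean (n + 1) q - c * (n : ℝ) ^ α)
      =o[atTop] fun n : ℕ => (n : ℝ) ^ α := by
    have h1 := (hq.comp_tendsto (tendsto_add_atTop_nat 1)).trans_isBigO
      ((nat_add_rpow_isBigO α 1).congr_left fun n => by simp)
    refine (h1.add (hsucc.const_mul_left c)).congr_left fun n => ?_
    simp only [Function.comp]
    ring
  have h1 := mul_sub_isLittleO hβ hβ
  have h2 := mul_sub_isLittleO hβ hq'
  simp only [hxx] at h1 h2
  have h3 := (nat_add_rpow_sub_isLittleO (2 * α + 1) 1).const_mul_left (2 * c ^ 2 / (2 * α + 1))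
  simp only [add_sub_cancel_right] at h3
  refine ((h1.add h2).sub h3).congr_left fun n => ?_
  have e := hν.mean_sq_step hs n
  rw [hν.mean_add _ (PolyBdd.const _) (hs.polyBdd.const_mul _), hν.mean_const,
    hν.mean_const_mul] at e
  rw [e]
  push_cast
  field_simp
  ring

theorem tendsto_mul_mean_scaledDiff_sq (hν : IsUrnLaw β r ν) {α L : ℝ}
    (h : (fun n => hν.mean n (fun k => (Φ k - A n) ^ 2) - L * (n : ℝ) ^ (2 * α + 1))
      =o[atTop] fun n : ℕ => (n : ℝ) ^ (2 * α + 1)) :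
    Tendsto (fun N : ℕ => N * hν.mean N (fun k => scaledDiff α Φ A N k ^ 2)) atTop (nhds L) := by
  have h1 := h.tendsto_div_nhds_zero.add_const L
  rw [zero_add] at h1
  refine h1.congr' ?_
  filter_upwards [eventually_gt_atTop 0] with N hN
  have hN' : (0 : ℝ) < N := by exact_mod_cast hN
  rw [hν.mean_scaledDiff_pow]
  have e : ((N : ℝ) ^ (α + 1)) ^ 2 = (N : ℝ) ^ (2 * α + 1) * N := by
    rw [← Real.rpow_add_one hN'.ne', ← Real.rpow_mul_natCast hN'.le]
    congr 1
    push_cast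
    ring
  rw [e]
  have : (0 : ℝ) < (N : ℝ) ^ (2 * α + 1) := by positivity
  field_simp
  ring

theorem tendsto_mean_sub_natCast (hν : IsUrnLaw β r ν) (hs : IsUrnScale β r q Φ A)
    {α κ d e L : ℝ} (hL : 0 ≤ L)
    (hexp : ∀ ε > 0, ∃ C > 0, ∀ᶠ N : ℕ in atTop, ∀ k : ℕ,
      |((k : ℝ) - N) - N * κ * scaledDiff α Φ A N k + d
          + e * (N * scaledDiff α Φ A N k ^ 2)|
        ≤ ε * (1 + N * scaledDiff α Φ A N k ^ 2) + C * (N * scaledDiff α Φ A N k ^ 4))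
    (h2 : Tendsto (fun N : ℕ => N * hν.mean N (fun k => scaledDiff α Φ A N k ^ 2)) atTop (nhds L))
    (h4 : ∃ K > 0, ∀ᶠ N : ℕ in atTop,
      hν.mean N (fun k => scaledDiff α Φ A N k ^ 4) ≤ K / (N : ℝ) ^ 2) :
    Tendsto (fun N : ℕ => hν.mean N (fun k => (k : ℝ) - N)) atTop (nhds (-d - e * L)) := by
  obtain ⟨K, hK, h4⟩ := h4
  have key : Tendsto (fun N : ℕ => hν.mean N (fun k => (k : ℝ) - N) + d
      + e * (N * hν.mean N (fun k => scaledDiff α Φ A N k ^ 2))) atTop (nhds 0) := by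
    rw [Metric.tendsto_nhds]
    intro ε hε
    obtain ⟨C, hC, h⟩ := hexp (ε / (2 * (L + 2))) (by positivity)
    filter_upwards [h, h4, h2.eventually_le_const (lt_add_one L), eventually_gt_atTop 0,
      tendsto_natCast_atTop_atTop.eventually_gt_atTop (2 * C * K / ε)] with N h h4 h2 hN0 hN
    have hN' : (0 : ℝ) < N := by exact_mod_cast hN0
    rw [Real.dist_eq, sub_zero]
    have p1 := hs.polyBdd_sum.scaledDiff α A N
    have p2 := (p1.pow 2).const_mul (N : ℝ)
    have p4 := (p1.pow 4).const_mul (N : ℝ)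
    have pk : PolyBdd fun k : ℕ => (k : ℝ) - N := PolyBdd.natCast.sub (PolyBdd.const _)
    have pd : PolyBdd fun _ : ℕ => d := PolyBdd.const d
    have p12 := (PolyBdd.const 1).add p2
    have hm0 : hν.mean N (fun k => scaledDiff α Φ A N k) = 0 := by
      simp only [scaledDiff, div_eq_inv_mul]
      rw [hν.mean_const_mul, hν.mean_sub_eq_zero hs, mul_zero]
    have h5 := hν.abs_mean_le N (((pk.sub (p1.const_mul _)).add pd).add (p2.const_mul e))
      ((p12.const_mul _).add (p4.const_mul C)) h
    rw [hν.mean_add _ ((pk.sub (p1.const_mul _)).add pd) (p2.const_mul e),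
      hν.mean_add _ (pk.sub (p1.const_mul _)) pd, hν.mean_sub _ pk (p1.const_mul _),
      hν.mean_add _ (p12.const_mul _) (p4.const_mul C)] at h5
    simp only [hν.mean_const_mul] at h5
    rw [hν.mean_add _ (PolyBdd.const 1) p2, hm0, mul_zero, sub_zero] at h5
    simp only [hν.mean_const, hν.mean_const_mul] at h5
    refine h5.trans_lt ?_
    have f1 : ε / (2 * (L + 2)) * (1 + N * hν.mean N (fun k => scaledDiff α Φ A N k ^ 2))
        ≤ ε / 2 := by
      calc _ ≤ ε / (2 * (L + 2)) * (L + 2) := mul_le_mul_of_nonneg_left (by linarith) (by positivity)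
        _ = _ := by field_simp
    have f2 : C * (N * hν.mean N (fun k => scaledDiff α Φ A N k ^ 4)) < ε / 2 := by
      calc _ ≤ C * (N * (K / (N : ℝ) ^ 2)) := by gcongr
        _ = C * K / N := by field_simp
        _ < ε / 2 := by
          rw [div_lt_iff₀ hN']
          rw [div_lt_iff₀ hε] at hN
          linarith
    linarith
  have h3 := (key.sub_const d).sub (h2.const_mul e)
  rw [zero_sub] at h3
  refine h3.congr fun N => ?_
  ring

end IsUrnLaw

open Asymptotics in
theorem WeightAsymp.tendsto_zero {w : ℕ → ℝ} {α B : ℝ} (hα : 0 < α) (hw : WeightAsymp w α B)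
    (s : ℕ) : Tendsto (fun j : ℕ => w (2 * j + s)) atTop (nhds 0) := by
  have h1 : Tendsto (fun j : ℕ => 2 ^ α * (j : ℝ) ^ α) atTop atTop :=
    ((tendsto_rpow_atTop hα).comp tendsto_natCast_atTop_atTop).const_mul_atTop (by positivity)
  have h2 : (fun j : ℕ => 1 / w (2 * j + s)) ~[atTop] fun j : ℕ => 2 ^ α * (j : ℝ) ^ α :=
    (hw.inv_isLittleO_leading s).trans_isBigO
      (isBigO_self_const_mul (by positivity) (fun j : ℕ => (j : ℝ) ^ α) atTop)
  have h3 := (h2.symm.tendsto_atTop h1).inv_tendsto_atTop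
  refine h3.congr fun j => ?_
  simp

theorem PolyBdd.of_tendsto {f : ℕ → ℝ} {a : ℝ} (h : Tendsto f atTop (nhds a)) : PolyBdd f := by
  obtain ⟨C, hC⟩ := (Metric.isBounded_range_of_tendsto f h).exists_norm_le
  exact ⟨C, 0, fun k => by simpa using hC (f k) ⟨k, rfl⟩⟩

open Asymptotics in
/-- The limit of the mean displacement, for weights satisfying the forward equations. -/
theorem IsUrnLaw.tendsto_mean_of_weightAsymp {w : ℕ → ℝ} {α B : ℝ} (hα : 0 < α)
    (hw0 : ∀ n, 0 < w n) (hw : WeightAsymp w α B) {ν : ℕ → ℕ → ℝ}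
    (hν : IsUrnLaw (fun n => 1 / w (2 * n)) (fun k => w (2 * k + 1)) ν) :
    Tendsto (fun N : ℕ => hν.mean N (fun k => (k : ℝ) - N)) atTop
      (nhds (-(4 * α + 1) / (2 * (2 * α + 1)))) := by
  have hc : (0 : ℝ) < 2 ^ α := by positivity
  have hg : (0 : ℝ) < 2 ^ α / (α + 1) := by positivity
  obtain ⟨Φ, hΦ⟩ : ∃ Φ : ℕ → ℝ, Φ = fun k => ∑ j ∈ Finset.range k, 1 / w (2 * j + 1) := ⟨_, rfl⟩
  obtain ⟨A, hA⟩ : ∃ A : ℕ → ℝ, A = fun n => ∑ j ∈ Finset.range n, 1 / w (2 * j) := ⟨_, rfl⟩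
  have hqL := hw.inv_isLittleO_leading 1
  have hβL : (fun j : ℕ => 1 / w (2 * j) - 2 ^ α * (j : ℝ) ^ α)
      =o[atTop] fun j : ℕ => (j : ℝ) ^ α := hw.inv_isLittleO_leading 0
  have pq : PolyBdd fun k => 1 / w (2 * k + 1) := PolyBdd.of_isLittleO hα hqL
  have hs : IsUrnScale (fun n => 1 / w (2 * n)) (fun k => w (2 * k + 1))
      (fun k => 1 / w (2 * k + 1)) Φ A :=
    { mul_eq_one := fun k => one_div_mul_cancel (hw0 _).ne'
      polyBdd := pq
      polyBdd_sum := hΦ ▸ pq.sum_range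
      succ_left := fun k => by rw [hΦ]; exact Finset.sum_range_succ _ _
      succ_right := fun n => by rw [hA]; exact Finset.sum_range_succ _ _
      init := by simp [hΦ, hA] }
  have hΦL : (fun k : ℕ => Φ k - 2 ^ α / (α + 1) * (k : ℝ) ^ (α + 1)
      - 2 ^ α * (B / α) * (k : ℝ) ^ α) =o[atTop] fun k : ℕ => (k : ℝ) ^ α := by
    refine (hw.sum_inv_isLittleO hα 1).congr_left fun k => ?_
    rw [hΦ]
    push_cast
    ring
  have hAL : (fun k : ℕ => A k - 2 ^ α / (α + 1) * (k : ℝ) ^ (α + 1)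
      - (2 ^ α * (B / α) - 2 ^ α / 2) * (k : ℝ) ^ α) =o[atTop] fun k : ℕ => (k : ℝ) ^ α := by
    refine (hw.sum_inv_isLittleO hα 0).congr_left fun k => ?_
    rw [hA]
    push_cast
    simp only [add_zero]
    ring
  have hdev := fun (ε : ℝ) (hε : ε > 0) => eventually_abs_scaledDiff_sub_le hα hΦL hAL hε
  obtain ⟨K, hK, hV⟩ := exists_eventually_abs_relDev_le hg (hdev 1 one_pos)
  obtain ⟨C, hC, hqT⟩ := exists_eventually_abs_le_mul_one_add hα hc hqL hK hV
  obtain ⟨C₁, hC₁, hβT⟩ := hβL.isBigO.exists_pos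
  have hT : ∀ᶠ n : ℕ in atTop, 1 / w (2 * n) ≤ (C + (C₁ + 2 ^ α)) * ((n + 1 : ℕ) : ℝ) ^ α ∧
      ∀ k, 1 / w (2 * k + 1) ≤ (C + (C₁ + 2 ^ α)) * ((n + 1 : ℕ) : ℝ) ^ α *
        (1 + |scaledDiff α Φ A (n + 1) k|) := by
    filter_upwards [hβT.bound, (tendsto_add_atTop_nat 1).eventually hqT] with n h1 h2
    constructor
    · rw [Real.norm_eq_abs, Real.norm_of_nonneg (by positivity)] at h1
      have h3 := (le_abs_self _).trans h1
      have h4 : (n : ℝ) ^ α ≤ ((n + 1 : ℕ) : ℝ) ^ α := by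
        gcongr
        linarith
      calc 1 / w (2 * n) ≤ (C₁ + 2 ^ α) * (n : ℝ) ^ α := by linarith
        _ ≤ (C + (C₁ + 2 ^ α)) * ((n + 1 : ℕ) : ℝ) ^ α :=
          mul_le_mul (by linarith) h4 (by positivity) (by positivity)
    · intro k
      refine ((le_abs_self _).trans (h2 k)).trans ?_
      gcongr
      exact le_add_of_nonneg_right (by positivity)
  have hC₂ : 0 < C + (C₁ + 2 ^ α) := by positivity
  have m2 := hν.exists_mean_scaledDiff_sq_le (hν.exists_mean_sq_le hs hα hC₂ hT)
  have m4 := hν.exists_mean_scaledDiff_four_le (hν.exists_mean_four_le hs hα hC₂ hT)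
  have hmq := hν.mean_inv_weight_isLittleO pq hs.polyBdd_sum
    (fun ε hε => exists_eventually_abs_sub_le_sq hα hc hqL hK hV hε) m2
  have h2 := hν.tendsto_mul_mean_scaledDiff_sq (hν.mean_sq_isLittleO hs hα hβL hmq)
  have h := hν.tendsto_mean_sub_natCast hs (by positivity)
    (fun ε hε => exists_eventually_abs_displacement_sub_le hα hg hdev hε) h2 m4
  convert h using 2
  have : 2 * α + 1 ≠ 0 := by positivity
  field_simp
  ring

namespace Urn

variable {Ω : Type*} [MeasurableSpace Ω] {μ : Measure Ω} {b r : ℕ → ℝ}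

theorem Bl_add_Re (U : Urn μ b r) (t : ℕ) (ω : Ω) : U.Bl t ω + U.Re t ω = t := by
  induction t with
  | zero => rw [U.init_Bl, U.init_Re]
  | succ t ih => rcases U.step t ω with ⟨h1, h2⟩ | ⟨h1, h2⟩ <;> omega

theorem Bl_mono (U : Urn μ b r) (ω : Ω) : Monotone fun t => U.Bl t ω :=
  monotone_nat_of_le_succ fun t => by rcases U.step t ω with ⟨h1, -⟩ | ⟨h1, -⟩ <;> omega

/-- Blue has `n` balls and red has `k` balls after `n + k` draws. -/
def visit (U : Urn μ b r) (n k : ℕ) : Set Ω := {ω | U.Bl (n + k) ω = n}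

/-- The `n`-th blue ball is drawn after exactly `k` red balls. -/
def arrive (U : Urn μ b r) (n k : ℕ) : Set Ω :=
  {ω | U.Bl (n + k) ω = n ∧ ∀ t < n + k, U.Bl t ω < n}

theorem measurableSet_visit (U : Urn μ b r) (n k : ℕ) : MeasurableSet (U.visit n k) :=
  U.meas_Bl (n + k) (measurableSet_singleton n)

theorem measurableSet_arrive (U : Urn μ b r) (n k : ℕ) : MeasurableSet (U.arrive n k) := by
  have h : U.arrive n k = U.visit n k ∩ ⋂ t, ⋂ (_ : t < n + k), {ω | U.Bl t ω < n} := by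
    ext ω
    simp [arrive, visit]
  rw [h]
  exact (U.measurableSet_visit n k).inter (MeasurableSet.iInter fun t =>
    MeasurableSet.iInter fun _ => U.meas_Bl t (measurableSet_Iio (a := n)))

theorem visit_zero (U : Urn μ b r) (n : ℕ) : U.visit n 0 = U.arrive n 0 := by
  ext ω
  refine ⟨fun h => ⟨h, fun t ht => ?_⟩, fun h => h.1⟩
  have := U.Bl_add_Re t ω
  omega

theorem arrive_succ (U : Urn μ b r) (n k : ℕ) :
    U.arrive (n + 1) k = U.visit n k ∩ {ω | U.Bl (n + k + 1) ω = U.Bl (n + k) ω + 1} := by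
  ext ω
  have e : n + 1 + k = n + k + 1 := by omega
  simp only [arrive, visit, e, Set.mem_inter_iff, Set.mem_ofPred_eq]
  constructor
  · rintro ⟨h1, h2⟩
    have h3 := h2 (n + k) (by omega)
    rcases U.step (n + k) ω with ⟨h4, -⟩ | ⟨h4, -⟩ <;> omega
  · rintro ⟨h1, h2⟩
    refine ⟨by omega, fun t ht => ?_⟩
    have : U.Bl t ω ≤ U.Bl (n + k) ω := U.Bl_mono ω (by omega)
    omega

theorem visit_succ (U : Urn μ b r) (n k : ℕ) :
    U.visit n (k + 1) = U.arrive n (k + 1) ∪ (U.visit n k \ U.arrive (n + 1) k) := by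
  ext ω
  rw [arrive_succ]
  simp only [arrive, visit, ← add_assoc, Set.mem_inter_iff, Set.mem_ofPred_eq, Set.mem_union,
    Set.mem_sdiff]
  constructor
  · intro h1
    rcases U.step (n + k) ω with ⟨h2, -⟩ | ⟨h2, -⟩
    · refine Or.inl ⟨h1, fun t ht => ?_⟩
      have : U.Bl t ω ≤ U.Bl (n + k) ω := U.Bl_mono ω (by omega)
      omega
    · right
      omega
  · rintro (h | ⟨h1, h2⟩)
    · exact h.1
    · rcases U.step (n + k) ω with ⟨h3, -⟩ | ⟨h3, -⟩ <;> omega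

theorem F_le (U : Urn μ b r) (n : ℕ) : U.F n ≤ ‹MeasurableSpace Ω› :=
  iSup₂_le fun j _ => ((U.meas_Bl j).prodMk (U.meas_Re j)).comap_le

theorem measurableSet_F_visit (U : Urn μ b r) (n k : ℕ) :
    MeasurableSet[U.F (n + k)] (U.visit n k) := by
  have h : MeasurableSpace.comap (fun ω => (U.Bl (n + k) ω, U.Re (n + k) ω)) inferInstance
      ≤ U.F (n + k) := le_iSup₂_of_le (n + k) Set.self_mem_Iic le_rfl
  exact h _ ⟨{p | p.1 = n}, measurable_fst (measurableSet_singleton n), rfl⟩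

theorem measureReal_arrive_succ [IsProbabilityMeasure μ] (U : Urn μ b r) (n k : ℕ) :
    μ.real (U.arrive (n + 1) k) = μ.real (U.visit n k) * (b n / (b n + r k)) := by
  have hS : MeasurableSet {ω | U.Bl (n + k + 1) ω = U.Bl (n + k) ω + 1} :=
    measurableSet_eq_fun (U.meas_Bl _) ((U.meas_Bl _).add_const 1)
  have hf : (fun ω => if U.Bl (n + k + 1) ω = U.Bl (n + k) ω + 1 then (1 : ℝ) else 0)
      = {ω | U.Bl (n + k + 1) ω = U.Bl (n + k) ω + 1}.indicator fun _ => 1 := by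
    ext ω
    simp [Set.indicator_apply]
  have hint : Integrable
      (fun ω => if U.Bl (n + k + 1) ω = U.Bl (n + k) ω + 1 then (1 : ℝ) else 0) μ := by
    rw [hf]
    exact (integrable_const 1).indicator hS
  have h1 := setIntegral_condExp (U.F_le (n + k)) hint (U.measurableSet_F_visit n k)
  have h2 : ∫ ω in U.visit n k,
      (μ[(fun ω => if U.Bl (n + k + 1) ω = U.Bl (n + k) ω + 1 then (1 : ℝ) else 0) |
        U.F (n + k)]) ω ∂μ = ∫ _ in U.visit n k, b n / (b n + r k) ∂μ := by
    refine setIntegral_congr_ae (U.measurableSet_visit n k) ?_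
    filter_upwards [U.markov (n + k)] with ω hω hv
    have h3 : U.Bl (n + k) ω = n := hv
    have h4 : U.Re (n + k) ω = k := by
      have := U.Bl_add_Re (n + k) ω
      omega
    rw [h3, h4] at hω
    exact hω
  rw [h2, hf, setIntegral_indicator hS, ← arrive_succ, setIntegral_const, setIntegral_const,
    smul_eq_mul, smul_eq_mul, mul_one] at h1
  exact h1.symm

theorem measureReal_visit_succ [IsProbabilityMeasure μ] (U : Urn μ b r) (n k : ℕ) :
    μ.real (U.visit n (k + 1)) = μ.real (U.arrive n (k + 1))
      + (μ.real (U.visit n k) - μ.real (U.arrive (n + 1) k)) := by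
  have hsub : U.arrive (n + 1) k ⊆ U.visit n k := by
    rw [arrive_succ]
    exact Set.inter_subset_left
  have hdisj : Disjoint (U.arrive n (k + 1)) (U.visit n k \ U.arrive (n + 1) k) := by
    refine Set.disjoint_left.2 fun ω h1 h2 => ?_
    have h3 := h1.2 (n + k) (by omega)
    have h4 : U.Bl (n + k) ω = n := h2.1
    omega
  rw [visit_succ, measureReal_union hdisj
    ((U.measurableSet_visit n k).diff (U.measurableSet_arrive _ _)),
    measureReal_sdiff hsub (U.measurableSet_arrive _ _)]

theorem isUrnLaw [IsProbabilityMeasure μ] (U : Urn μ b r) (hb : ∀ i, 0 < b i) (hr : ∀ i, 0 < r i)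
    (hr0 : Tendsto r atTop (nhds 0)) :
    IsUrnLaw (fun n => 1 / b n) r fun n k => μ.real (U.arrive n k) where
  β_pos n := one_div_pos.2 (hb n)
  r_pos := hr
  tendsto_r := hr0
  polyBdd_r := PolyBdd.of_tendsto hr0
  nonneg _ _ := measureReal_nonneg
  init k := by
    rcases k with - | k
    · have : U.arrive 0 0 = Set.univ := by
        ext ω
        simp [arrive, U.init_Bl]
      simp [this]
    · have : U.arrive 0 (k + 1) = ∅ := by
        ext ω
        simp only [arrive, Set.mem_ofPred_eq, Set.mem_empty_iff_false, iff_false]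
        exact fun h => absurd (h.2 0 (by omega)) (by omega)
      simp [this]
  zero n := by
    have h1 := hb n
    have h2 := hr 0
    rw [measureReal_arrive_succ, visit_zero]
    field_simp
  succ n k := by
    have h1 := hb n
    have h2 := hr k
    have h3 := hr (k + 1)
    have e := U.measureReal_visit_succ n k
    rw [measureReal_arrive_succ] at e
    rw [measureReal_arrive_succ, measureReal_arrive_succ, e]
    field_simp
    ring

theorem tau_eq (U : Urn μ b r) {n m : ℕ} {ω : Ω} (h : U.Bl m ω = n) (h' : ∀ t < m, U.Bl t ω < n) :
    U.tau n ω = m := by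
  induction n generalizing m with
  | zero =>
    rcases m with - | m
    · rfl
    · exact absurd (h' 0 (by omega)) (by omega)
  | succ n ih =>
    obtain ⟨m, rfl⟩ : ∃ m', m = m' + 1 := Nat.exists_eq_succ_of_ne_zero fun h0 => by
      rw [h0, U.init_Bl] at h
      omega
    have hm : U.Bl m ω = n := by
      have := h' m (by omega)
      rcases U.step m ω with ⟨h1, -⟩ | ⟨h1, -⟩ <;> omega
    have hex : ∃ t, U.Bl t ω = n := ⟨m, hm⟩
    obtain ⟨p, hp⟩ : ∃ p, p = Nat.find hex := ⟨_, rfl⟩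
    have hpn : U.Bl p ω = n := hp ▸ Nat.find_spec hex
    have hpm : p ≤ m := hp ▸ Nat.find_min' hex hm
    have htau : U.tau n ω = p := ih hpn fun t ht => by
      have h1 : U.Bl t ω ≤ U.Bl p ω := U.Bl_mono ω ht.le
      have h2 := Nat.find_min hex (hp ▸ ht)
      omega
    refine IsLeast.csInf_eq ⟨⟨by omega, ?_⟩, ?_⟩
    · rw [Nat.add_sub_cancel, h, hm]
    · rintro s ⟨h1, h2⟩
      by_contra! hlt
      have h3 := h' s hlt
      have h4 : U.Bl p ω ≤ U.Bl (s - 1) ω := U.Bl_mono ω (by omega)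
      omega

theorem D_tau_of_mem_arrive (U : Urn μ b r) {n k : ℕ} {ω : Ω} (h : ω ∈ U.arrive n k) :
    (U.D (U.tau n ω) ω : ℝ) = k - n := by
  have h1 : U.Bl (n + k) ω = n := h.1
  have h2 : U.Re (n + k) ω = k := by
    have := U.Bl_add_Re (n + k) ω
    omega
  rw [U.tau_eq h.1 h.2, D, h1, h2]
  push_cast
  rfl

theorem pairwise_disjoint_arrive (U : Urn μ b r) (n : ℕ) :
    Pairwise (Function.onFun Disjoint (U.arrive n)) := by
  have key : ∀ i j ω, i < j → ω ∈ U.arrive n i → ω ∉ U.arrive n j := fun i j ω hij h1 h2 => by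
    have h3 := h2.2 (n + i) (by omega)
    have h4 := h1.1
    omega
  intro i j hij
  refine Set.disjoint_left.2 fun ω h1 h2 => ?_
  rcases hij.lt_or_gt with h | h
  · exact key i j ω h h1 h2
  · exact key j i ω h h2 h1

theorem integral_D_tau [IsProbabilityMeasure μ] (U : Urn μ b r)
    (hν : IsUrnLaw (fun n => 1 / b n) r fun n k => μ.real (U.arrive n k)) (n : ℕ) :
    ∫ ω, (U.D (U.tau n ω) ω : ℝ) ∂μ = hν.mean n fun k => (k : ℝ) - n := by
  have hm := U.measurableSet_arrive n
  have hd := U.pairwise_disjoint_arrive n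
  have hmass : μ.real (⋃ k, U.arrive n k) = 1 := by
    have h1 := integral_iUnion (μ := μ) (f := fun _ => (1 : ℝ)) hm hd
      (integrable_const 1).integrableOn
    simp only [setIntegral_const, smul_eq_mul] at h1
    rw [mul_one] at h1
    exact h1.trans (hν.mean_const n 1)
  have hae : ∀ᵐ ω ∂μ, ω ∈ ⋃ k, U.arrive n k := by
    refine (prob_compl_eq_zero_iff (MeasurableSet.iUnion hm)).2 ?_
    rwa [measureReal_def, ENNReal.toReal_eq_one_iff] at hmass
  have hint : ∀ k, IntegrableOn (fun ω => (U.D (U.tau n ω) ω : ℝ)) (U.arrive n k) μ := fun k =>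
    (integrable_const ((k : ℝ) - n)).integrableOn.congr_fun
      (fun ω hω => (U.D_tau_of_mem_arrive hω).symm) (hm k)
  have hval : ∀ g : ℝ → ℝ, ∀ k, ∫ ω in U.arrive n k, g (U.D (U.tau n ω) ω : ℝ) ∂μ
      = μ.real (U.arrive n k) * g (k - n) := fun g k => by
    rw [setIntegral_congr_fun (g := fun _ => g (k - n)) (hm k)
      fun ω hω => congrArg g (U.D_tau_of_mem_arrive hω), setIntegral_const, smul_eq_mul]
  have hU : IntegrableOn (fun ω => (U.D (U.tau n ω) ω : ℝ)) (⋃ k, U.arrive n k) μ := by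
    refine integrableOn_iUnion_of_summable_integral_norm hint ?_
    simp only [hval fun x => ‖x‖]
    exact hν.summable n (PolyBdd.natCast.sub (PolyBdd.const _)).abs
  rw [← setIntegral_eq_integral_of_ae_compl_eq_zero
    (hae.mono fun ω h h' => absurd h h'), integral_iUnion hm hd hU]
  exact tsum_congr (hval fun x => x)

end Urn

theorem mean_discrepancy_at_tau_limit_minus {Ω : Type*} [MeasurableSpace Ω] (μ : MeasureTheory.Measure Ω) [MeasureTheory.IsProbabilityMeasure μ]
    (α B : ℝ) (hα : 0 < α) (w : ℕ → ℝ) (hw : ∀ n, 0 < w n)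
    (hasymp : WeightAsymp w α B)
    (b r : ℕ → ℝ) (hb : ∀ i, 0 < b i) (hr : ∀ i, 0 < r i)
    (hbr : ∀ i, b i = w (2*i) ∧ r i = w (2*i+1)) (U : Urn μ b r) :
    Tendsto (fun n : ℕ => ∫ ω, (U.D (U.tau n ω) ω : ℝ) ∂μ)
      atTop (nhds (-(4*α + 1) / (2*(2*α + 1)))) := by
  obtain rfl : b = fun i => w (2 * i) := funext fun i => (hbr i).1
  obtain rfl : r = fun i => w (2 * i + 1) := funext fun i => (hbr i).2
  have hν := U.isUrnLaw hb hr (hasymp.tendsto_zero hα 1)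
  simp only [U.integral_D_tau hν]
  exact hν.tendsto_mean_of_weightAsymp hα hw hasymp
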